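/- arXiv:solv-int/9707011 — 10 statements merged into one kernel-verified Lean document; each statement's English description precedes it below -/
import Mathlib

section
/- Let f : ℝ → ℝ be a polynomial such that f'''(u) < 0 for all u ∈ ℝ. Define σ(u₁,u₂,u₃) = (1/(2√2 π)) ∫_{-1}^{1} ∫_{-1}^{1} f( ((1+s)(1+t)/4)·u₁ + ((1-s)(1+t)/4)·u₂ + ((1-t)/2)·u₃ ) / √((1-t)(1-s²)) dt ds. Then for every l ∈ {1,2,3} and every (u₁,u₂,u₃) ∈ ℝ³, the second partial derivative ∂²/∂u_l² of the function D(u₁,u₂,u₃) := ∂σ/∂u₁ + ∂σ/∂u₂ + ∂σ/∂u₃ is strictly negative. Consequently the equation (∂/∂u_l)² D(u₁,u₂,u₃) = 0 has no real solution; this is the key step showing that for initial data with f''' < 0 the solution of the one-phase Whitham equations has no point of gradient catastrophe (Theorem 4.1). -/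
open MeasureTheory intervalIntegral

/-- The function σ(u₁,u₂,u₃) defined by the double improper integral
    (1/(2√2 π)) ∫_{-1}^{1}∫_{-1}^{1} f(((1+s)(1+t)/4)u₁+((1-s)(1+t)/4)u₂+((1-t)/2)u₃)
      /√((1-t)(1-s²)) dt ds. -/
noncomputable def sigmaFun (f : ℝ → ℝ) (u₁ u₂ u₃ : ℝ) : ℝ :=
  (1 / (2 * Real.sqrt 2 * Real.pi)) *
    ∫ s in (-1 : ℝ)..1, ∫ t in (-1 : ℝ)..1,
      f ((1 + s) * (1 + t) / 4 * u₁ + (1 - s) * (1 + t) / 4 * u₂ + (1 - t) / 2 * u₃) /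
        Real.sqrt ((1 - t) * (1 - s ^ 2))

/-- D(u₁,u₂,u₃) = ∂σ/∂u₁ + ∂σ/∂u₂ + ∂σ/∂u₃. -/
noncomputable def Dfun (f : ℝ → ℝ) (u₁ u₂ u₃ : ℝ) : ℝ :=
  deriv (fun a => sigmaFun f a u₂ u₃) u₁ + deriv (fun a => sigmaFun f u₁ a u₃) u₂ +
    deriv (fun a => sigmaFun f u₁ u₂ a) u₃

open Polynomial in
/-- Differentiation under the integral sign for a polynomial in a variable depending affinely on
the parameter, against a finite measure carried by a compact set. -/
theorem hasDerivAt_integral_mul_eval_affine {Z : Type*} [TopologicalSpace Z] [MeasurableSpace Z]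
    [OpensMeasurableSpace Z] {μ : Measure Z} [IsFiniteMeasure μ] {K : Set Z}
    (hK : IsCompact K) (hμ : ∀ᵐ z ∂μ, z ∈ K) (p : ℝ[X]) {h b x : Z → ℝ} {y : ℝ → Z → ℝ}
    (hh : Continuous h) (hb : Continuous b) (hx : Continuous x)
    (hy : ∀ a z, y a z = x z + a * b z) (a : ℝ) :
    HasDerivAt (fun a => ∫ z, h z * p.eval (y a z) ∂μ)
      (∫ z, h z * b z * p.derivative.eval (y a z) ∂μ) a := by
  obtain rfl : y = fun a z => x z + a * b z := by ext a z; exact hy a z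
  have hF : ∀ a, Continuous fun z => h z * p.eval (x z + a * b z) := fun a => by fun_prop
  have hF' : Continuous fun q : ℝ × Z =>
      h q.2 * b q.2 * p.derivative.eval (x q.2 + q.1 * b q.2) := by fun_prop
  obtain ⟨B, hB⟩ := hK.exists_bound_of_continuousOn (hF a).continuousOn
  obtain ⟨C, hC⟩ :=
    ((isCompact_closedBall a 1).prod hK).exists_bound_of_continuousOn hF'.continuousOn
  refine (hasDerivAt_integral_of_dominated_loc_of_deriv_le (bound := fun _ => C)
    (F' := fun a z => h z * b z * p.derivative.eval (x z + a * b z))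
    (Metric.closedBall_mem_nhds a one_pos)
    (.of_forall fun a => (hF a).aestronglyMeasurable)
    (.of_bound (hF a).aestronglyMeasurable B (hμ.mono hB))
    (hF'.comp (by fun_prop : Continuous fun z : Z => (a, z))).aestronglyMeasurable
    (hμ.mono fun z hz a ha => hC (a, z) ⟨ha, hz⟩) (integrable_const C)
    (.of_forall fun z a _ => ?_)).2
  have h₁ : HasDerivAt (fun a => x z + a * b z) (b z) a := by
    simpa using ((hasDerivAt_id a).mul_const (b z)).const_add (x z)
  simpa [mul_assoc, mul_left_comm, mul_comm] using
    ((p.hasDerivAt _).comp a h₁).const_mul (h z)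

/-- The measure on `(-1, 1)` with density `w`. -/
noncomputable def weightMeasure (w : ℝ → ℝ) : Measure ℝ :=
  (volume.restrict (Set.Ioo (-1) 1)).withDensity fun x => ENNReal.ofReal (w x)

theorem isFiniteMeasure_weightMeasure {w : ℝ → ℝ}
    (hw : IntervalIntegrable w volume (-1) 1) : IsFiniteMeasure (weightMeasure w) :=
  isFiniteMeasure_withDensity_ofReal
    ((intervalIntegrable_iff_integrableOn_Ioo_of_le (by norm_num)).1 hw).2

theorem ae_mem_Ioo_weightMeasure (w : ℝ → ℝ) :
    ∀ᵐ x ∂weightMeasure w, x ∈ Set.Ioo (-1 : ℝ) 1 :=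
  (withDensity_absolutelyContinuous _ _).ae_le (ae_restrict_mem measurableSet_Ioo)

theorem integral_weightMeasure {w : ℝ → ℝ} (hw : Measurable w) (hw₀ : ∀ x, 0 ≤ w x)
    (g : ℝ → ℝ) : ∫ x, g x ∂weightMeasure w = ∫ x in (-1 : ℝ)..1, w x * g x := by
  rw [weightMeasure, integral_withDensity_eq_integral_toReal_smul hw.ennreal_ofReal (by simp),
    integral_of_le (by norm_num), integral_Ioc_eq_integral_Ioo]
  simp [ENNReal.toReal_ofReal, hw₀]

theorem weightMeasure_ne_zero {w : ℝ → ℝ} (hw : Measurable w)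
    (hpos : ∀ x ∈ Set.Ioo (-1 : ℝ) 1, 0 < w x) : weightMeasure w ≠ 0 := by
  rw [weightMeasure, Ne, withDensity_eq_zero_iff hw.ennreal_ofReal.aemeasurable]
  intro h
  have h₁ : ∀ᵐ x ∂volume.restrict (Set.Ioo (-1 : ℝ) 1), False := by
    filter_upwards [h, ae_restrict_mem measurableSet_Ioo] with x hx hx'
    exact (hpos x hx').not_ge (by simpa using hx)
  rw [Filter.eventually_false_iff_eq_bot, ae_eq_bot, Measure.restrict_eq_zero] at h₁
  norm_num at h₁

/-- The weight `(1 - s²)^{-1/2}` of the outer integral in `sigmaFun`. -/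
noncomputable def outerWeight (s : ℝ) : ℝ := (√(1 - s ^ 2))⁻¹

/-- The weight `(1 - t)^{-1/2}` of the inner integral in `sigmaFun`. -/
noncomputable def innerWeight (t : ℝ) : ℝ := (√(1 - t))⁻¹

theorem measurable_outerWeight : Measurable outerWeight := by
  unfold outerWeight; fun_prop

theorem measurable_innerWeight : Measurable innerWeight := by
  unfold innerWeight; fun_prop

theorem intervalIntegrable_outerWeight : IntervalIntegrable outerWeight volume (-1) 1 := by
  have h := Polynomial.Chebyshev.intervalIntegrable_sqrt_one_sub_sq_inv
  simp only [Real.sqrt_inv] at h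
  exact h

theorem intervalIntegrable_innerWeight : IntervalIntegrable innerWeight volume (-1) 1 := by
  have h : IntervalIntegrable (fun x : ℝ => x ^ (-(1 / 2) : ℝ)) volume 2 0 :=
    intervalIntegrable_rpow' (by norm_num)
  have h₁ := h.comp_sub_left 1
  norm_num at h₁
  refine h₁.congr fun t ht => ?_
  rw [Set.uIoc_of_le (by norm_num)] at ht
  rw [innerWeight, Real.sqrt_eq_rpow, ← Real.rpow_neg (by linarith [ht.2])]

/-- The measure on the square `(-1, 1)²` defining `sigmaFun`, without its normalization. -/
noncomputable def sigmaMeasure : Measure (ℝ × ℝ) :=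
  (weightMeasure outerWeight).prod (weightMeasure innerWeight)

instance : IsFiniteMeasure (weightMeasure outerWeight) :=
  isFiniteMeasure_weightMeasure intervalIntegrable_outerWeight

instance : IsFiniteMeasure (weightMeasure innerWeight) :=
  isFiniteMeasure_weightMeasure intervalIntegrable_innerWeight

instance : IsFiniteMeasure sigmaMeasure := by
  unfold sigmaMeasure; infer_instance

theorem sigmaMeasure_ne_zero : sigmaMeasure ≠ 0 := by
  rw [sigmaMeasure, Ne, ← Measure.measure_univ_eq_zero, ← Set.univ_prod_univ, Measure.prod_prod,
    mul_eq_zero, Measure.measure_univ_eq_zero, Measure.measure_univ_eq_zero, not_or]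
  refine ⟨weightMeasure_ne_zero measurable_outerWeight fun s hs => ?_,
    weightMeasure_ne_zero measurable_innerWeight fun t ht => ?_⟩
  · have : 0 < 1 - s ^ 2 := by nlinarith [hs.1, hs.2]
    unfold outerWeight; positivity
  · have : 0 < 1 - t := by linarith [ht.2]
    unfold innerWeight; positivity

theorem ae_mem_Ioo_sigmaMeasure :
    ∀ᵐ z ∂sigmaMeasure, z ∈ Set.Ioo (-1 : ℝ) 1 ×ˢ Set.Ioo (-1 : ℝ) 1 :=
  (Measure.quasiMeasurePreserving_fst.ae (ae_mem_Ioo_weightMeasure outerWeight)).and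
    (Measure.quasiMeasurePreserving_snd.ae (ae_mem_Ioo_weightMeasure innerWeight))

theorem ae_mem_Icc_sigmaMeasure :
    ∀ᵐ z ∂sigmaMeasure, z ∈ Set.Icc (-1 : ℝ) 1 ×ˢ Set.Icc (-1 : ℝ) 1 :=
  ae_mem_Ioo_sigmaMeasure.mono fun _ hz =>
    Set.prod_mono Set.Ioo_subset_Icc_self Set.Ioo_subset_Icc_self hz

theorem integrable_sigmaMeasure {g : ℝ × ℝ → ℝ} (hg : Continuous g) :
    Integrable g sigmaMeasure := by
  obtain ⟨C, hC⟩ :=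
    (isCompact_Icc.prod isCompact_Icc).exists_bound_of_continuousOn hg.continuousOn
  exact .of_bound hg.aestronglyMeasurable C (ae_mem_Icc_sigmaMeasure.mono hC)

/-- The argument of `f` in the definition of `sigmaFun`. -/
noncomputable def sigmaArg (u₁ u₂ u₃ : ℝ) (z : ℝ × ℝ) : ℝ :=
  (1 + z.1) * (1 + z.2) / 4 * u₁ + (1 - z.1) * (1 + z.2) / 4 * u₂ + (1 - z.2) / 2 * u₃

@[fun_prop]
theorem continuous_sigmaArg (u₁ u₂ u₃ : ℝ) : Continuous (sigmaArg u₁ u₂ u₃) := by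
  unfold sigmaArg; fun_prop

theorem sigmaFun_eq_integral {f : ℝ → ℝ} (hf : Continuous f) (u₁ u₂ u₃ : ℝ) :
    sigmaFun f u₁ u₂ u₃ = 1 / (2 * √2 * Real.pi) *
      ∫ z, f (sigmaArg u₁ u₂ u₃ z) ∂sigmaMeasure := by
  have hi : Integrable (fun z => f (sigmaArg u₁ u₂ u₃ z)) sigmaMeasure :=
    integrable_sigmaMeasure (by fun_prop)
  rw [sigmaFun, sigmaMeasure, integral_prod _ hi,
    integral_weightMeasure measurable_outerWeight (fun s => by unfold outerWeight; positivity)]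
  congr 1
  refine integral_congr fun s _ => ?_
  rw [integral_weightMeasure measurable_innerWeight (fun t => by unfold innerWeight; positivity),
    ← intervalIntegral.integral_const_mul]
  refine integral_congr fun t ht => ?_
  rw [Set.uIcc_of_le (by norm_num)] at ht
  simp only [sigmaArg, outerWeight, innerWeight]
  rw [Real.sqrt_mul (by linarith [ht.2]), div_eq_mul_inv, mul_inv]
  ring

open Polynomial

theorem hasDerivAt_integral_sigmaArg (p : ℝ[X]) {h b x : ℝ × ℝ → ℝ} {y : ℝ → ℝ × ℝ → ℝ}
    (hh : Continuous h) (hb : Continuous b) (hx : Continuous x)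
    (hy : ∀ a z, y a z = x z + a * b z) (a : ℝ) :
    HasDerivAt (fun a => ∫ z, h z * p.eval (y a z) ∂sigmaMeasure)
      (∫ z, h z * b z * p.derivative.eval (y a z) ∂sigmaMeasure) a :=
  hasDerivAt_integral_mul_eval_affine (isCompact_Icc.prod isCompact_Icc)
    ae_mem_Icc_sigmaMeasure p hh hb hx hy a

/-- The derivative of `sigmaFun` along a line, `y` being the argument of the polynomial. -/
theorem deriv_sigmaFun_line (p : ℝ[X]) {b x : ℝ × ℝ → ℝ} {y : ℝ → ℝ × ℝ → ℝ}
    (hb : Continuous b) (hx : Continuous x) (hy : ∀ a z, y a z = x z + a * b z) {F : ℝ → ℝ} {c : ℝ}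
    (hF : ∀ a, F a = c * ∫ z, p.eval (y a z) ∂sigmaMeasure) (a : ℝ) :
    deriv F a = c * ∫ z, b z * p.derivative.eval (y a z) ∂sigmaMeasure := by
  obtain rfl : F = _ := funext hF
  have h := hasDerivAt_integral_sigmaArg p (h := fun _ => 1) continuous_const hb hx hy a
  simp only [one_mul] at h
  exact (h.const_mul c).deriv

/-- The operator `∂₁ + ∂₂ + ∂₃` turns `σ` for `p` into `σ` for its derivative, since the coefficients of
the argument sum to one. -/
theorem Dfun_eval_eq_sigmaFun (p : ℝ[X]) (u₁ u₂ u₃ : ℝ) :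
    Dfun (fun x => p.eval x) u₁ u₂ u₃ = sigmaFun (fun x => p.derivative.eval x) u₁ u₂ u₃ := by
  have hF := fun u₁ u₂ u₃ => sigmaFun_eq_integral p.continuous u₁ u₂ u₃
  rw [Dfun,
    deriv_sigmaFun_line p (b := fun z => (1 + z.1) * (1 + z.2) / 4) (x := sigmaArg 0 u₂ u₃)
      (by fun_prop) (by fun_prop) (fun a z => by simp only [sigmaArg]; ring)
      (fun a => hF a u₂ u₃) u₁,
    deriv_sigmaFun_line p (b := fun z => (1 - z.1) * (1 + z.2) / 4) (x := sigmaArg u₁ 0 u₃)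
      (by fun_prop) (by fun_prop) (fun a z => by simp only [sigmaArg]; ring)
      (fun a => hF u₁ a u₃) u₂,
    deriv_sigmaFun_line p (b := fun z => (1 - z.2) / 2) (x := sigmaArg u₁ u₂ 0)
      (by fun_prop) (by fun_prop) (fun a z => by simp only [sigmaArg]; ring)
      (fun a => hF u₁ u₂ a) u₃,
    sigmaFun_eq_integral p.derivative.continuous, ← mul_add, ← mul_add,
    ← integral_add (integrable_sigmaMeasure (by fun_prop)) (integrable_sigmaMeasure (by fun_prop)),
    ← integral_add (integrable_sigmaMeasure (by fun_prop)) (integrable_sigmaMeasure (by fun_prop))]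
  congr 2
  ext z
  ring

/-- A function which is `σ` for `p` along a line has negative second derivative if
`p` does. -/
theorem iteratedDeriv_two_sigmaFun_line_neg {p : ℝ[X]}
    (hp : ∀ x, p.derivative.derivative.eval x < 0) {b x : ℝ × ℝ → ℝ} {y : ℝ → ℝ × ℝ → ℝ}
    (hb : Continuous b) (hx : Continuous x) (hy : ∀ a z, y a z = x z + a * b z)
    (hb₀ : ∀ s ∈ Set.Ioo (-1 : ℝ) 1, ∀ t ∈ Set.Ioo (-1 : ℝ) 1, 0 < b (s, t))
    {F : ℝ → ℝ} {c : ℝ} (hc : 0 < c)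
    (hF : ∀ a, F a = c * ∫ z, p.eval (y a z) ∂sigmaMeasure) (a : ℝ) :
    iteratedDeriv 2 F a < 0 := by
  rw [iteratedDeriv_succ, iteratedDeriv_one, funext (deriv_sigmaFun_line p hb hx hy hF),
    ((hasDerivAt_integral_sigmaArg p.derivative hb hb hx hy a).const_mul c).deriv]
  have hneg : ∀ᵐ z ∂sigmaMeasure, 0 < -(b z * b z * p.derivative.derivative.eval (y a z)) := by
    filter_upwards [ae_mem_Ioo_sigmaMeasure] with z hz
    have := hb₀ z.1 hz.1 z.2 hz.2
    have := mul_pos this this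
    nlinarith [hp (y a z)]
  have hy' : Continuous (y a) := by
    rw [funext (hy a)]; fun_prop
  have hpos := (integral_pos_iff_support_of_nonneg_ae (hneg.mono fun z hz => hz.le)
    (integrable_sigmaMeasure (by fun_prop))).2 <| pos_iff_ne_zero.2 fun h => by
      have h₁ : ∀ᵐ z ∂sigmaMeasure, False := by
        filter_upwards [hneg, measure_eq_zero_iff_ae_notMem.1 h] with z hz hz'
        exact hz' hz.ne'
      exact sigmaMeasure_ne_zero (by simpa using h₁)
  rw [MeasureTheory.integral_neg] at hpos
  exact mul_neg_of_pos_of_neg hc (by linarith)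

/-- If f is a polynomial with f'''(u) < 0 for all u, then for each l ∈ {1,2,3}
    the second partial derivative of D with respect to u_l is strictly negative
    everywhere; in particular (∂/∂u_l)² D = 0 has no real solution. -/
theorem stmt0 (f : ℝ → ℝ) (hpoly : ∃ p : Polynomial ℝ, ∀ x, f x = p.eval x)
    (hf3 : ∀ u : ℝ, iteratedDeriv 3 f u < 0) (u₁ u₂ u₃ : ℝ) :
    iteratedDeriv 2 (fun a => Dfun f a u₂ u₃) u₁ < 0 ∧
    iteratedDeriv 2 (fun a => Dfun f u₁ a u₃) u₂ < 0 ∧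
    iteratedDeriv 2 (fun a => Dfun f u₁ u₂ a) u₃ < 0 := by
  obtain ⟨p, hp⟩ := hpoly
  obtain rfl : f = fun x => p.eval x := funext hp
  have hp₃ : ∀ u, p.derivative.derivative.derivative.eval u < 0 := by
    have hd : ∀ q : ℝ[X], deriv (fun x => q.eval x) = fun x => q.derivative.eval x :=
      fun q => funext fun _ => q.deriv
    simpa only [iteratedDeriv_succ, iteratedDeriv_zero, hd] using hf3
  have hF := fun u₁ u₂ u₃ => (Dfun_eval_eq_sigmaFun p u₁ u₂ u₃).trans
    (sigmaFun_eq_integral p.derivative.continuous u₁ u₂ u₃)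
  have hc : 0 < 1 / (2 * √2 * Real.pi) := by positivity
  refine ⟨?_, ?_, ?_⟩
  · refine iteratedDeriv_two_sigmaFun_line_neg hp₃ (b := fun z => (1 + z.1) * (1 + z.2) / 4)
      (x := sigmaArg 0 u₂ u₃) (by fun_prop) (by fun_prop)
      (fun a z => by simp only [sigmaArg]; ring) (fun s hs t ht => ?_) hc
      (fun a => hF a u₂ u₃) u₁
    have := mul_pos (neg_lt_iff_pos_add'.1 hs.1) (neg_lt_iff_pos_add'.1 ht.1)
    positivity
  · refine iteratedDeriv_two_sigmaFun_line_neg hp₃ (b := fun z => (1 - z.1) * (1 + z.2) / 4)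
      (x := sigmaArg u₁ 0 u₃) (by fun_prop) (by fun_prop)
      (fun a z => by simp only [sigmaArg]; ring) (fun s hs t ht => ?_) hc
      (fun a => hF u₁ a u₃) u₂
    have := mul_pos (sub_pos.2 hs.2) (neg_lt_iff_pos_add'.1 ht.1)
    positivity
  · refine iteratedDeriv_two_sigmaFun_line_neg hp₃ (b := fun z => (1 - z.2) / 2)
      (x := sigmaArg u₁ u₂ 0) (by fun_prop) (by fun_prop)
      (fun a z => by simp only [sigmaArg]; ring) (fun s hs t ht => ?_) hc
      (fun a => hF u₁ u₂ a) u₃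
    have := sub_pos.2 ht.2
    positivity
end

section
/- Let f : ℝ → ℝ be a polynomial of odd degree with negative leading coefficient, and set t_c := (1/6)·inf_{u∈ℝ}(−f'(u)). Assume t_c > 0. Then for every t with 0 ≤ t < t_c and every x ∈ ℝ there exists a unique u = U(x,t) ∈ ℝ satisfying x = 6 t u + f(u); moreover the resulting function U(x,t) is differentiable on ℝ × [0, t_c) and satisfies the Burgers (zero-phase Whitham) equation ∂_t U + 6 U ∂_x U = 0, with U(x,0) equal to the inverse function of f. -/
open Filter Topology

/-- A differentiable function whose derivative is bounded above by a negative constant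
is a bijection of the real line. -/
theorem bijective_of_deriv_le_neg {h : ℝ → ℝ} (hd : Differentiable ℝ h) {c : ℝ} (hc : 0 < c)
    (hle : ∀ u, deriv h u ≤ -c) : Function.Bijective h := by
  have hsub : ∀ a b, a ≤ b → h b - h a ≤ -c * (b - a) := fun a b hab =>
    image_sub_le_mul_sub_of_deriv_le hd hle hab
  refine ⟨(strictAnti_of_deriv_neg fun u => (hle u).trans_lt (neg_lt_zero.mpr hc)).injective,
    fun x => ?_⟩
  set r := |h 0 - x| / c with hr
  have hr0 : 0 ≤ r := by positivity
  have hcr : c * r = |h 0 - x| := by rw [hr]; field_simp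
  have hright := hsub 0 r hr0
  have hleft := hsub (-r) 0 (by linarith)
  have habs := abs_le.mp (le_refl |h 0 - x|)
  obtain ⟨u, -, hu⟩ := intermediate_value_Icc' (show -r ≤ r by linarith)
    hd.continuous.continuousOn
    (show x ∈ Set.Icc (h r) (h (-r)) from ⟨by linarith, by linarith⟩)
  exact ⟨u, hu⟩

theorem ContinuousLinearMap.isInvertible_of_apply_one_ne_zero {𝕜 : Type*}
    [NontriviallyNormedField 𝕜] (L : 𝕜 →L[𝕜] 𝕜) (hL : L 1 ≠ 0) : L.IsInvertible :=
  ⟨ContinuousLinearEquiv.unitsEquivAut 𝕜 (Units.mk0 (L 1) hL), by ext; simp⟩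

/-- A solution `U` of the hodograph equation `x = 6tu + f(u)`, unique for all times `t < T`, is
differentiable wherever the equation is nondegenerate. -/
theorem differentiableAt_of_hodograph {f : ℝ → ℝ} (hf : ContDiff ℝ 1 f) {U : ℝ → ℝ → ℝ} {T : ℝ}
    (hU : ∀ x t, t < T → x = 6 * t * U x t + f (U x t))
    (huniq : ∀ x t, t < T → ∀ u, x = 6 * t * u + f u → u = U x t)
    {x t : ℝ} (ht : t < T) (hne : 6 * t + deriv f (U x t) ≠ 0) :
    DifferentiableAt ℝ (fun q : ℝ × ℝ => U q.1 q.2) (x, t) := by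
  let F : (ℝ × ℝ) × ℝ → ℝ := fun v => 6 * v.1.2 * v.2 + f v.2 - v.1.1
  let a : (ℝ × ℝ) × ℝ := ((x, t), U x t)
  have hF : ContDiffAt ℝ 1 F a := by
    have : ContDiff ℝ 1 F := by fun_prop
    exact this.contDiffAt
  have hFa : F a = 0 := by
    have := hU x t ht
    simp only [F, a]
    linarith
  have hpartial : (fderiv ℝ F a ∘L .inr ℝ (ℝ × ℝ) ℝ) 1 = 6 * t + deriv f (U x t) := by
    have h1 : HasDerivAt (fun u : ℝ => (((x, t), u) : (ℝ × ℝ) × ℝ)) ((0, 0), 1) (U x t) :=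
      (hasDerivAt_const _ _).prodMk (hasDerivAt_id _)
    have h2 := (hF.differentiableAt one_ne_zero).hasFDerivAt.comp_hasDerivAt (U x t) h1
    have h3 : HasDerivAt (fun u => 6 * t * u + f u - x) (6 * t + deriv f (U x t)) (U x t) := by
      simpa using (((hasDerivAt_id (U x t)).const_mul (6 * t)).add
        (hf.differentiable one_ne_zero (U x t)).hasDerivAt).sub_const x
    exact h2.unique h3
  have hinv := ContinuousLinearMap.isInvertible_of_apply_one_ne_zero _ (hpartial ▸ hne)
  have hdiff : DifferentiableAt ℝ (hF.implicitFunction one_ne_zero hinv) (x, t) :=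
    (hF.hasStrictFDerivAt_implicitFunction one_ne_zero hinv).hasFDerivAt.differentiableAt
  refine hdiff.congr_of_eventuallyEq ?_
  have hlt : ∀ᶠ q : ℝ × ℝ in 𝓝 (x, t), q.2 < T :=
    continuous_snd.continuousAt.eventually_lt continuousAt_const ht
  filter_upwards [hlt, hF.eventually_apply_implicitFunction one_ne_zero hinv] with q hq hq'
  rw [hFa] at hq'
  refine (huniq q.1 q.2 hq _ ?_).symm
  simp only [F] at hq'
  linarith

/-- A differentiable solution of the hodograph equation `x = 6tu + f(u)` satisfies the Burgers
equation wherever the hodograph equation is nondegenerate. -/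
theorem burgers_of_hodograph {f : ℝ → ℝ} (hf : Differentiable ℝ f) {U : ℝ → ℝ → ℝ} {T : ℝ}
    (hU : ∀ x t, t < T → x = 6 * t * U x t + f (U x t))
    {x t : ℝ} (ht : t < T) (hne : 6 * t + deriv f (U x t) ≠ 0)
    (hdiff : DifferentiableAt ℝ (fun q : ℝ × ℝ => U q.1 q.2) (x, t)) :
    deriv (fun s => U x s) t + 6 * U x t * deriv (fun y => U y t) x = 0 := by
  have hUx : HasDerivAt (fun y => U y t) (deriv (fun y => U y t) x) x :=
    (hdiff.comp (f := fun y : ℝ => (y, t)) x (by fun_prop)).hasDerivAt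
  have hUt : HasDerivAt (fun s => U x s) (deriv (fun s => U x s) t) t :=
    (hdiff.comp (f := fun s : ℝ => (x, s)) t (by fun_prop)).hasDerivAt
  have hfU := (hf (U x t)).hasDerivAt
  have hx := (hUx.const_mul (6 * t)).add (hfU.comp x hUx)
  have ht' := (((hasDerivAt_id t).const_mul 6).mul hUt).add (hfU.comp t hUt)
  have hx1 := hx.unique ((hasDerivAt_id x).congr_of_eventuallyEq
    (Eventually.of_forall fun y => (hU y t ht).symm))
  have ht1 := ht'.unique ((hasDerivAt_const t x).congr_of_eventuallyEq
    ((eventually_lt_nhds ht).mono fun s hs => (hU x s hs).symm))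
  simp only [id, mul_one] at hx1 ht1
  refine (mul_eq_zero.mp ?_).resolve_left hne
  linear_combination ht1 + 6 * U x t * hx1



/-- For polynomial initial data f of odd degree with negative leading coefficient and
    t_c = (1/6)·inf_u(−f'(u)) > 0, for every 0 ≤ t < t_c and every x there is a unique
    u = U(x,t) with x = 6tu + f(u); U is differentiable on ℝ × [0,t_c), satisfies the
    Burgers equation ∂_t U + 6 U ∂_x U = 0, and U(·,0) is the inverse function of f. -/
theorem stmt1 (p : Polynomial ℝ) (hodd : Odd p.natDegree) (hlead : p.leadingCoeff < 0)
    (f : ℝ → ℝ) (hf : ∀ x, f x = p.eval x)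
    (tc : ℝ) (htc : tc = (1 / 6) * sInf (Set.range fun u => -(deriv f u)))
    (htcpos : 0 < tc) :
    ∃ U : ℝ → ℝ → ℝ,
      (∀ x t : ℝ, 0 ≤ t → t < tc →
        (x = 6 * t * U x t + f (U x t) ∧ ∀ u : ℝ, x = 6 * t * u + f u → u = U x t)) ∧
      DifferentiableOn ℝ (fun q : ℝ × ℝ => U q.1 q.2) (Set.univ ×ˢ Set.Ico 0 tc) ∧
      (∀ x t : ℝ, 0 ≤ t → t < tc →
        deriv (fun s => U x s) t + 6 * U x t * deriv (fun y => U y t) x = 0) ∧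
      (∀ x : ℝ, f (U x 0) = x) := by
  have hfp : f = fun x => p.eval x := funext hf
  have hcont : ContDiff ℝ 1 f := by
    rw [hfp]
    simpa using p.contDiff_aeval (𝕜 := ℝ) 1
  have hfd : Differentiable ℝ f := hcont.differentiable one_ne_zero
  have hbdd : BddBelow (Set.range fun u => -(deriv f u)) := by
    by_contra hb
    rw [Real.sInf_of_not_bddBelow hb] at htc
    linarith
  have hderiv : ∀ u, deriv f u ≤ -(6 * tc) := fun u => by
    have := csInf_le hbdd (Set.mem_range_self u)
    linarith
  have hbij : ∀ t < tc, Function.Bijective fun u => 6 * t * u + f u := fun t ht => by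
    have hd : ∀ u, HasDerivAt (fun u => 6 * t * u + f u) (6 * t + deriv f u) u := fun u => by
      simpa using ((hasDerivAt_id u).const_mul (6 * t)).fun_add (hfd u).hasDerivAt
    refine bijective_of_deriv_le_neg (fun u => (hd u).differentiableAt)
      (c := 6 * (tc - t)) (by linarith) fun u => ?_
    rw [(hd u).deriv]
    linarith [hderiv u]
  have hne : ∀ t < tc, ∀ u, 6 * t + deriv f u ≠ 0 := fun t ht u => by
    have h : 6 * t + deriv f u < 0 := by linarith [hderiv u]
    exact h.ne
  have hex : ∀ x t, ∃ u, t < tc → x = 6 * t * u + f u := fun x t => by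
    by_cases ht : t < tc
    · obtain ⟨u, hu⟩ := (hbij t ht).surjective x
      exact ⟨u, fun _ => hu.symm⟩
    · exact ⟨0, fun h => absurd h ht⟩
  choose U hU using hex
  have huniq : ∀ x t, t < tc → ∀ u, x = 6 * t * u + f u → u = U x t := fun x t ht u hu =>
    (hbij t ht).injective (hu.symm.trans (hU x t ht))
  have hdiff : ∀ x t, t < tc → DifferentiableAt ℝ (fun q : ℝ × ℝ => U q.1 q.2) (x, t) :=
    fun x t ht => differentiableAt_of_hodograph hcont hU huniq ht (hne t ht _)
  refine ⟨U, fun x t _ ht => ⟨hU x t ht, huniq x t ht⟩,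
    fun q hq => (hdiff q.1 q.2 hq.2.2).differentiableWithinAt,
    fun x t _ ht => burgers_of_hodograph hfd hU ht (hne t ht _) (hdiff x t ht), fun x => ?_⟩
  have := hU x 0 htcpos
  linarith
end

section
/- Let f : ℝ → ℝ be a polynomial of odd degree with negative leading coefficient, let F be an antiderivative of f, and set t_c := (1/6)·inf_{u∈ℝ}(−f'(u)). Then for every x ∈ ℝ and every t with 0 ≤ t < t_c, the function G⁰(u) := x·u − 3 t u² − F(u) is strictly convex on ℝ, tends to +∞ as u → ±∞, and has a unique global minimizer u* ∈ ℝ; this minimizer is characterized by the characteristic equation x = 6 t u* + f(u*). -/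
/-- A differentiable function whose derivative grows at least linearly with slope `c`
lies above each of its tangent lines by at least `c / 2` times the squared distance. -/
lemma tangent_add_sq_le_of_hasDerivAt {G g : ℝ → ℝ} {c : ℝ} (hG : ∀ u, HasDerivAt G (g u) u)
    (hg : Monotone fun u => g u - c * u) (a y : ℝ) :
    G a + g a * (y - a) + c / 2 * (y - a) ^ 2 ≤ G y := by
  have hK : ∀ u, HasDerivAt (fun u => G u - c / 2 * u ^ 2) (g u - c * u) u := fun u =>
    ((hG u).sub ((hasDerivAt_pow 2 u).const_mul (c / 2))).congr_deriv (by push_cast; ring)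
  have hconv : ConvexOn ℝ Set.univ fun u => G u - c / 2 * u ^ 2 := by
    refine Monotone.convexOn_univ_of_deriv (fun u => (hK u).differentiableAt) ?_
    rwa [funext fun u => (hK u).deriv]
  rcases lt_trichotomy a y with h | rfl | h
  · have := hconv.le_slope_of_hasDerivAt (Set.mem_univ a) (Set.mem_univ y) h (hK a)
    rw [slope_def_field, le_div_iff₀ (sub_pos.2 h)] at this
    linarith
  · simp
  · have := hconv.slope_le_of_hasDerivAt (Set.mem_univ y) (Set.mem_univ a) h (hK a)
    rw [slope_def_field, div_le_iff₀ (sub_pos.2 h)] at this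
    linarith

/-- A quadratic polynomial with positive leading coefficient tends to `+∞` at infinity. -/
lemma tendsto_quadratic_cocompact (a b : ℝ) {c : ℝ} (hc : 0 < c) :
    Filter.Tendsto (fun u : ℝ => a + b * u + c * u ^ 2) (Filter.cocompact ℝ) Filter.atTop := by
  have hsq : Filter.Tendsto (fun u : ℝ => c / 2 * ‖u‖ ^ 2 + (a - b ^ 2 / (2 * c)))
      (Filter.cocompact ℝ) Filter.atTop :=
    Filter.tendsto_atTop_add_const_right _ _ <| Filter.Tendsto.const_mul_atTop (by positivity) <|
      (Filter.tendsto_pow_atTop two_ne_zero).comp (tendsto_norm_cocompact_atTop (E := ℝ))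
  refine Filter.tendsto_atTop_mono (fun u => ?_) hsq
  have : a + b * u + c * u ^ 2 - (c / 2 * u ^ 2 + (a - b ^ 2 / (2 * c)))
      = (c * u + b) ^ 2 / (2 * c) := by
    field_simp
    ring
  have : 0 ≤ (c * u + b) ^ 2 / (2 * c) := by positivity
  rw [Real.norm_eq_abs, sq_abs]
  linarith

/-- For polynomial initial data f of odd degree with negative leading coefficient,
    F an antiderivative of f and t_c = (1/6)·inf_u(−f'(u)), for every x and
    0 ≤ t < t_c the function G⁰(u) = xu − 3tu² − F(u) is strictly convex, tends to +∞
    as u → ±∞, has a unique global minimizer, and the minimizers are exactly the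
    solutions of the characteristic equation x = 6tu + f(u). -/
theorem stmt2 (p : Polynomial ℝ) (hodd : Odd p.natDegree) (hlead : p.leadingCoeff < 0)
    (f F : ℝ → ℝ) (hf : ∀ x, f x = p.eval x) (hF : ∀ u : ℝ, HasDerivAt F (f u) u)
    (tc : ℝ) (htc : tc = (1 / 6) * sInf (Set.range fun u => -(deriv f u)))
    (x t : ℝ) (ht0 : 0 ≤ t) (ht : t < tc) :
    StrictConvexOn ℝ Set.univ (fun u => x * u - 3 * t * u ^ 2 - F u) ∧
    Filter.Tendsto (fun u => x * u - 3 * t * u ^ 2 - F u) Filter.atTop Filter.atTop ∧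
    Filter.Tendsto (fun u => x * u - 3 * t * u ^ 2 - F u) Filter.atBot Filter.atTop ∧
    (∃! ustar : ℝ, ∀ y : ℝ,
        x * ustar - 3 * t * ustar ^ 2 - F ustar ≤ x * y - 3 * t * y ^ 2 - F y) ∧
    (∀ u : ℝ,
        (∀ y : ℝ, x * u - 3 * t * u ^ 2 - F u ≤ x * y - 3 * t * y ^ 2 - F y) ↔
          x = 6 * t * u + f u) := by
  have hdf : ∀ u, HasDerivAt f (deriv f u) u := fun u => by
    rw [funext hf]
    exact p.differentiable.differentiableAt.hasDerivAt
  have hbdd : BddBelow (Set.range fun u => -(deriv f u)) := by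
    by_contra h
    rw [Real.sInf_of_not_bddBelow h] at htc
    linarith
  have hderiv : ∀ u, 6 * tc ≤ -(deriv f u) := fun u => by
    have := csInf_le hbdd (Set.mem_range_self u)
    linarith
  have hc : 0 < 6 * (tc - t) := by linarith
  set c := 6 * (tc - t) with hcdef
  have hG : ∀ u, HasDerivAt (fun u => x * u - 3 * t * u ^ 2 - F u) (x - 6 * t * u - f u) u :=
    fun u => ((((hasDerivAt_id u).const_mul x).sub
      ((hasDerivAt_pow 2 u).const_mul (3 * t))).sub (hF u)).congr_deriv (by push_cast; ring)
  have hmono : Monotone fun u => x - 6 * t * u - f u - c * u := by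
    have hd : ∀ u, HasDerivAt (fun u => x - 6 * t * u - f u - c * u)
        (-(6 * t) - deriv f u - c) u := fun u =>
      (((((hasDerivAt_id u).const_mul (6 * t)).const_sub x).sub (hdf u)).sub
        ((hasDerivAt_id u).const_mul c)).congr_deriv (by ring)
    refine monotone_of_deriv_nonneg (fun u => (hd u).differentiableAt) fun u => ?_
    rw [(hd u).deriv]
    linarith [hderiv u]
  have htan := tangent_add_sq_le_of_hasDerivAt hG hmono
  have hcrit : ∀ u : ℝ,
      (∀ y : ℝ, x * u - 3 * t * u ^ 2 - F u ≤ x * y - 3 * t * y ^ 2 - F y) ↔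
        x = 6 * t * u + f u := by
    refine fun u => ⟨fun h => ?_, fun h y => ?_⟩
    · have := IsLocalMin.hasDerivAt_eq_zero (Filter.Eventually.of_forall h) (hG u)
      linarith
    · have h0 : x - 6 * t * u - f u = 0 := by linarith
      have := htan u y
      rw [h0] at this
      nlinarith [mul_nonneg hc.le (sq_nonneg (y - u))]
  have hlim : Filter.Tendsto (fun u => x * u - 3 * t * u ^ 2 - F u)
      (Filter.cocompact ℝ) Filter.atTop := by
    refine Filter.tendsto_atTop_mono (fun u => ?_) (tendsto_quadratic_cocompact
      (x * 0 - 3 * t * 0 ^ 2 - F 0) (x - 6 * t * 0 - f 0) (half_pos hc))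
    simpa only [sub_zero] using htan 0 u
  have hstrict : StrictConvexOn ℝ Set.univ (fun u => x * u - 3 * t * u ^ 2 - F u) := by
    refine StrictMono.strictConvexOn_univ_of_deriv
      (continuous_iff_continuousAt.2 fun u => (hG u).continuousAt) ?_
    rw [funext fun u => (hG u).deriv]
    intro u v huv
    have := hmono huv.le
    have := mul_lt_mul_of_pos_left huv hc
    dsimp only at *
    linarith
  refine ⟨hstrict, hlim.mono_left atTop_le_cocompact,
    hlim.mono_left atBot_le_cocompact, ?_, hcrit⟩
  obtain ⟨u, hu⟩ := Continuous.exists_forall_le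
    (continuous_iff_continuousAt.2 fun u => (hG u).continuousAt) hlim
  exact ⟨u, hu, fun v hv => hstrict.eq_of_isMinOn (fun y _ => hv y) (fun y _ => hu y)
    (Set.mem_univ v) (Set.mem_univ u)⟩
end

section
/- Let c be a real number with √(10/3) < c < √15/2, and set u₁ := −(3/10)(c + √(c² − 10/3)) and t₁ := (1/6)(3 u₁² + 4 c u₁³ + 5 u₁⁴). Then: (i) 6 u₁ + 12 c u₁² + 20 u₁³ = 0 (i.e. f_c''(u₁) = 0, where f_c(u) = −(u³ + c u⁴ + u⁵)); (ii) 6 + 24 c u₁ + 60 u₁² > 0 (i.e. f_c'''(u₁) < 0); (iii) t₁ > 0. Thus (u₁, t₁) is a second point of gradient catastrophe of the solution of the Burgers equation with initial data x = f_c(u), occurring at positive time. -/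
/-- For √(10/3) < c < √15/2, the point u₁ = −(3/10)(c + √(c²−10/3)) with
    t₁ = (1/6)(3u₁² + 4cu₁³ + 5u₁⁴) satisfies f_c''(u₁) = 0, f_c'''(u₁) < 0 and t₁ > 0:
    a second point of gradient catastrophe of the Burgers solution at positive time. -/
theorem stmt6 (c : ℝ) (hc1 : Real.sqrt (10 / 3) < c) (hc2 : c < Real.sqrt 15 / 2)
    (u₁ t₁ : ℝ) (hu : u₁ = -(3 / 10) * (c + Real.sqrt (c ^ 2 - 10 / 3)))
    (ht : t₁ = (1 / 6) * (3 * u₁ ^ 2 + 4 * c * u₁ ^ 3 + 5 * u₁ ^ 4)) :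
    6 * u₁ + 12 * c * u₁ ^ 2 + 20 * u₁ ^ 3 = 0 ∧
    0 < 6 + 24 * c * u₁ + 60 * u₁ ^ 2 ∧
    0 < t₁ := by
  have hc0 : 0 < c := (Real.sqrt_nonneg _).trans_lt hc1
  have hcl : 10 / 3 < c ^ 2 := (Real.sqrt_lt' hc0).1 hc1
  have h15 : Real.sqrt 15 ^ 2 = 15 := Real.sq_sqrt (by norm_num)
  have h15pos : 0 < Real.sqrt 15 := Real.sqrt_pos.2 (by norm_num)
  have hs2 : Real.sqrt (c ^ 2 - 10 / 3) ^ 2 = c ^ 2 - 10 / 3 := Real.sq_sqrt (by linarith)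
  have hs0 : 0 < Real.sqrt (c ^ 2 - 10 / 3) := Real.sqrt_pos.2 (by linarith)
  have hs_lt : Real.sqrt (c ^ 2 - 10 / 3) < Real.sqrt 15 / 6 :=
    (Real.sqrt_lt' (by positivity)).2 (by nlinarith)
  generalize Real.sqrt (c ^ 2 - 10 / 3) = s at *
  have hquad : 10 * u₁ ^ 2 + 6 * c * u₁ + 3 = 0 := by
    subst hu
    linear_combination (9 / 10) * hs2
  have hu_lower : 3 / 10 < u₁ ^ 2 := by
    subst hu
    nlinarith [mul_pos hc0 hs0, sq_nonneg s]
  have hu_upper : u₁ ^ 2 < 3 / 5 := by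
    have h : c + s < 2 / 3 * Real.sqrt 15 := by linarith
    have h2 : (c + s) ^ 2 < (2 / 3 * Real.sqrt 15) ^ 2 :=
      pow_lt_pow_left₀ h (by positivity) two_ne_zero
    subst hu
    nlinarith
  refine ⟨by linear_combination 2 * u₁ * hquad, by linarith, ?_⟩
  have ht' : t₁ = u₁ ^ 2 * (3 / 5 - u₁ ^ 2) * (5 / 18) := by
    rw [ht]
    linear_combination (1 / 9) * u₁ ^ 2 * hquad
  rw [ht']
  have := mul_pos (show 0 < u₁ ^ 2 by linarith) (sub_pos.2 hu_upper)
  positivity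
end

section
/- Let c be a real number with −√15/2 < c < −√(10/3), and set u₁ := −(3/10)(c − √(c² − 10/3)) and t₁ := (1/6)(3 u₁² + 4 c u₁³ + 5 u₁⁴). Then: (i) 6 u₁ + 12 c u₁² + 20 u₁³ = 0 (i.e. f_c''(u₁) = 0, where f_c(u) = −(u³ + c u⁴ + u⁵)); (ii) 6 + 24 c u₁ + 60 u₁² > 0 (i.e. f_c'''(u₁) < 0); (iii) t₁ > 0. Thus (u₁, t₁) is a second point of gradient catastrophe of the solution of the Burgers equation with initial data x = f_c(u), occurring at positive time. -/
/-- For −√15/2 < c < −√(10/3), the point u₁ = −(3/10)(c − √(c²−10/3)) with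
    t₁ = (1/6)(3u₁² + 4cu₁³ + 5u₁⁴) satisfies f_c''(u₁) = 0, f_c'''(u₁) < 0 and t₁ > 0:
    a second point of gradient catastrophe of the Burgers solution at positive time. -/
theorem stmt7 (c : ℝ) (hc1 : -(Real.sqrt 15 / 2) < c) (hc2 : c < -Real.sqrt (10 / 3))
    (u₁ t₁ : ℝ) (hu : u₁ = -(3 / 10) * (c - Real.sqrt (c ^ 2 - 10 / 3)))
    (ht : t₁ = (1 / 6) * (3 * u₁ ^ 2 + 4 * c * u₁ ^ 3 + 5 * u₁ ^ 4)) :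
    6 * u₁ + 12 * c * u₁ ^ 2 + 20 * u₁ ^ 3 = 0 ∧
    0 < 6 + 24 * c * u₁ + 60 * u₁ ^ 2 ∧
    0 < t₁ := by
  have hc_neg : c < 0 := hc2.trans_le (neg_nonpos.mpr (Real.sqrt_nonneg _))
  have hc_sq_gt : 10 / 3 < c ^ 2 := by
    have h := (Real.sqrt_lt' (neg_pos.mpr hc_neg)).mp (lt_neg_of_lt_neg hc2)
    rwa [neg_sq] at h
  have h15 : Real.sqrt 15 ^ 2 = 15 := Real.sq_sqrt (by norm_num)
  have hc_sq_lt : c ^ 2 < 15 / 4 := by nlinarith [Real.sqrt_nonneg 15]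
  have hs_pos : 0 < Real.sqrt (c ^ 2 - 10 / 3) := Real.sqrt_pos.mpr (by linarith)
  have hs_sq : Real.sqrt (c ^ 2 - 10 / 3) ^ 2 = c ^ 2 - 10 / 3 := Real.sq_sqrt (by linarith)
  set s := Real.sqrt (c ^ 2 - 10 / 3)
  have hs_lt : s < Real.sqrt 15 / 6 :=
    lt_of_pow_lt_pow_left₀ 2 (by positivity) (by rw [div_pow, h15]; linarith)
  have hu_pos : 0 < u₁ := by linarith
  have hu_lt : u₁ < Real.sqrt 15 / 5 := by linarith
  have hu_sq : u₁ ^ 2 < 3 / 5 := by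
    have h := pow_lt_pow_left₀ hu_lt hu_pos.le two_ne_zero
    rw [div_pow, h15] at h
    linarith
  have hroot : 10 * u₁ ^ 2 + 6 * c * u₁ + 3 = 0 := by
    rw [hu]
    linear_combination (9 / 10) * hs_sq
  refine ⟨by linear_combination 2 * u₁ * hroot, ?_, ?_⟩
  · have h : 6 + 24 * c * u₁ + 60 * u₁ ^ 2 = 12 * u₁ * s := by
      linear_combination 2 * hroot + 40 * u₁ * hu
    rw [h]
    positivity
  · have h : t₁ = u₁ ^ 2 * (1 - 5 / 3 * u₁ ^ 2) / 6 := by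
      linear_combination ht + u₁ ^ 2 / 9 * hroot
    rw [h]
    have : 0 < 1 - 5 / 3 * u₁ ^ 2 := by linarith
    positivity
end

section
/- For a real parameter c, let f_c(u) = −(u³ + c u⁴ + u⁵). Then for all real u, v one has the identity (1/(2√2)) ∫_{-1}^{1} f_c( ((1+m)/2)·v + ((1−m)/2)·u ) / √(1−m) dm = q_c(u,v), where q_c(u,v) = −(1/35)(5u³ + 6u²v + 8uv² + 16v³) − (c/315)(35u⁴ + 40u³v + 48u²v² + 64uv³ + 128v⁴) − (1/693)(63u⁵ + 70u⁴v + 80u³v² + 96u²v³ + 128uv⁴ + 256v⁵). -/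
open MeasureTheory intervalIntegral

/-- The one-parameter family of initial data f_c(u) = −(u³ + c u⁴ + u⁵). -/
def fc (c u : ℝ) : ℝ := -(u ^ 3 + c * u ^ 4 + u ^ 5)

/-- The polynomial q_c(u,v) of equation (4.6). -/
noncomputable def qc (c u v : ℝ) : ℝ :=
  -(1 / 35) * (5 * u ^ 3 + 6 * u ^ 2 * v + 8 * u * v ^ 2 + 16 * v ^ 3) -
    c / 315 * (35 * u ^ 4 + 40 * u ^ 3 * v + 48 * u ^ 2 * v ^ 2 + 64 * u * v ^ 3 +
      128 * v ^ 4) -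
    1 / 693 * (63 * u ^ 5 + 70 * u ^ 4 * v + 80 * u ^ 3 * v ^ 2 + 96 * u ^ 2 * v ^ 3 +
      128 * u * v ^ 4 + 256 * v ^ 5)

lemma pow_div_sqrt_eq_rpow {x : ℝ} (hx : 0 < x) (n : ℕ) :
    x ^ n / Real.sqrt x = x ^ ((n : ℝ) - 1 / 2) := by
  rw [Real.rpow_sub hx, Real.rpow_natCast, Real.sqrt_eq_rpow]

lemma intervalIntegrable_pow_div_sqrt {a : ℝ} (ha : 0 ≤ a) (n : ℕ) :
    IntervalIntegrable (fun x : ℝ => x ^ n / Real.sqrt x) volume 0 a := by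
  have h : IntervalIntegrable (fun x : ℝ => x ^ ((n : ℝ) - 1 / 2)) volume 0 a :=
    intervalIntegrable_rpow' (by have : (0 : ℝ) ≤ n := n.cast_nonneg; linarith)
  refine h.congr fun x hx => ?_
  rw [Set.uIoc_of_le ha] at hx
  exact (pow_div_sqrt_eq_rpow hx.1 n).symm

lemma integral_pow_div_sqrt {a : ℝ} (ha : 0 < a) (n : ℕ) :
    ∫ x in (0 : ℝ)..a, x ^ n / Real.sqrt x = 2 * a ^ n * Real.sqrt a / (2 * n + 1) := by
  have hn : (0 : ℝ) ≤ n := n.cast_nonneg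
  have h : ∫ x in (0 : ℝ)..a, x ^ n / Real.sqrt x = ∫ x in (0 : ℝ)..a, x ^ ((n : ℝ) - 1 / 2) := by
    refine integral_congr_ae (Filter.Eventually.of_forall fun x hx => ?_)
    rw [Set.uIoc_of_le ha.le] at hx
    exact pow_div_sqrt_eq_rpow hx.1 n
  have he : (n : ℝ) - 1 / 2 + 1 = n + 1 / 2 := by ring
  rw [h, integral_rpow (Or.inl (by linarith)), he, Real.zero_rpow (by positivity),
    Real.rpow_add ha, Real.rpow_natCast, ← Real.sqrt_eq_rpow]
  field_simp
  ring

/-- Integration of a polynomial against the weight `1 / √x`, term by term. -/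
lemma integral_sum_pow_div_sqrt {a : ℝ} (ha : 0 < a) (N : ℕ) (p : ℕ → ℝ) :
    ∫ x in (0 : ℝ)..a, (∑ k ∈ Finset.range N, p k * x ^ k) / Real.sqrt x =
      ∑ k ∈ Finset.range N, p k * (2 * a ^ k * Real.sqrt a / (2 * k + 1)) := by
  simp_rw [Finset.sum_div, mul_div_assoc]
  rw [integral_finsetSum fun k _ => (intervalIntegrable_pow_div_sqrt ha.le k).const_mul (p k)]
  refine Finset.sum_congr rfl fun k _ => ?_
  rw [intervalIntegral.integral_const_mul, integral_pow_div_sqrt ha, mul_div_assoc]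

/-- The Taylor coefficients of `x ↦ fc c (v + x * w)` at `0`. -/
def fcCoeff (c v w : ℝ) : ℕ → ℝ
  | 0 => -(v ^ 3 + c * v ^ 4 + v ^ 5)
  | 1 => -(3 * v ^ 2 + 4 * c * v ^ 3 + 5 * v ^ 4) * w
  | 2 => -(3 * v + 6 * c * v ^ 2 + 10 * v ^ 3) * w ^ 2
  | 3 => -(1 + 4 * c * v + 10 * v ^ 2) * w ^ 3
  | 4 => -(c + 5 * v) * w ^ 4
  | 5 => -w ^ 5
  | _ => 0

lemma fc_add_mul (c v w x : ℝ) :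
    fc c (v + x * w) = ∑ k ∈ Finset.range 6, fcCoeff c v w k * x ^ k := by
  simp only [Finset.sum_range_succ, Finset.sum_range_zero, fcCoeff, fc]
  ring

/-- The integral representation
    (1/(2√2)) ∫_{-1}^{1} f_c(((1+m)/2)v + ((1−m)/2)u)/√(1−m) dm = q_c(u,v). -/
theorem stmt8 (c u v : ℝ) :
    (1 / (2 * Real.sqrt 2)) *
        ∫ m in (-1 : ℝ)..1, fc c ((1 + m) / 2 * v + (1 - m) / 2 * u) / Real.sqrt (1 - m) =
      qc c u v := by
  have h : ∀ m : ℝ, fc c ((1 + m) / 2 * v + (1 - m) / 2 * u) / Real.sqrt (1 - m) =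
      (fun x => (∑ k ∈ Finset.range 6, fcCoeff c v ((u - v) / 2) k * x ^ k) / Real.sqrt x)
        (1 - m) := fun m => by
    simp only [← fc_add_mul]
    congr 2
    ring
  simp_rw [h]
  rw [integral_comp_sub_left (fun x => (∑ k ∈ Finset.range 6,
    fcCoeff c v ((u - v) / 2) k * x ^ k) / Real.sqrt x) 1, sub_self, sub_neg_eq_add,
    one_add_one_eq_two, integral_sum_pow_div_sqrt two_pos]
  have hs : Real.sqrt 2 ≠ 0 := by positivity
  simp only [Finset.sum_range_succ, Finset.sum_range_zero, fcCoeff, qc]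
  push_cast
  field_simp
  ring
end

section
/- Let f : ℝ → ℝ be a polynomial and define q_f(u,v) := (1/(2√2)) ∫_{-1}^{1} f( ((1+m)/2)·v + ((1−m)/2)·u ) / √(1−m) dm. Then for every u ∈ ℝ: (i) (∂_u q_f + ∂_v q_f)(u,u) = f'(u); (ii) (∂_u q_f)(u,u) = f'(u)/3. Consequently, in the limit v → u the trailing-edge equation 6t + ∂_v q_f(u,v) + ∂_u q_f(u,v) = 0 and the leading-edge equation 2t + ∂_u q_f(u,v) = 0 both reduce to the zero-phase breaking condition 6t + f'(u) = 0. -/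
open MeasureTheory intervalIntegral

/-- q_f(u,v) := (1/(2√2)) ∫_{-1}^{1} f(((1+m)/2)v + ((1−m)/2)u)/√(1−m) dm. -/
noncomputable def qf (f : ℝ → ℝ) (u v : ℝ) : ℝ :=
  (1 / (2 * Real.sqrt 2)) *
    ∫ m in (-1 : ℝ)..1, f ((1 + m) / 2 * v + (1 - m) / 2 * u) / Real.sqrt (1 - m)

/-- The weight `1 / √(1 - m)` is integrable up to its singularity at `m = 1`. -/
lemma intervalIntegrable_one_div_sqrt_one_sub :
    IntervalIntegrable (fun m : ℝ => 1 / Real.sqrt (1 - m)) volume (-1) 1 := by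
  have h := ((intervalIntegrable_rpow' (a := 0) (b := 2) (r := -(1 / 2))
    (by norm_num)).comp_sub_left 1).symm
  norm_num only at h
  refine h.congr_uIoo fun m hm => ?_
  rw [Set.uIoo_of_le (by norm_num)] at hm
  have hm' : 0 ≤ 1 - m := by linarith [hm.2]
  simp only
  rw [Real.sqrt_eq_rpow, Real.rpow_neg hm', ← one_div]

lemma integral_one_div_sqrt_one_sub :
    ∫ m in (-1 : ℝ)..1, 1 / Real.sqrt (1 - m) = 2 * Real.sqrt 2 := by
  rw [intervalIntegral.integral_comp_sub_left (fun x => 1 / Real.sqrt x)]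
  norm_num only
  have h : ∫ x in (0 : ℝ)..2, 1 / Real.sqrt x = ∫ x in (0 : ℝ)..2, x ^ (-(1 / 2) : ℝ) := by
    refine intervalIntegral.integral_congr fun x hx => ?_
    rw [Set.uIcc_of_le (by norm_num)] at hx
    rw [Real.sqrt_eq_rpow, Real.rpow_neg hx.1, ← one_div]
  rw [h, integral_rpow (Or.inl (by norm_num)), Real.sqrt_eq_rpow]
  norm_num
  ring

lemma integral_sqrt_one_sub :
    ∫ m in (-1 : ℝ)..1, Real.sqrt (1 - m) = 4 * Real.sqrt 2 / 3 := by
  rw [intervalIntegral.integral_comp_sub_left (fun x => Real.sqrt x)]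
  norm_num only
  simp only [Real.sqrt_eq_rpow]
  rw [integral_rpow (Or.inl (by norm_num))]
  have h : (2 : ℝ) ^ ((1 / 2 : ℝ) + 1) = 2 ^ (1 / 2 : ℝ) * 2 := by
    rw [Real.rpow_add (by norm_num), Real.rpow_one]
  rw [h, Real.zero_rpow (by norm_num)]
  ring

lemma one_sub_div_two_div_sqrt (m : ℝ) :
    (1 - m) / 2 / Real.sqrt (1 - m) = 1 / 2 * Real.sqrt (1 - m) := by
  have h := Real.div_sqrt (x := 1 - m)
  rw [div_right_comm, h]
  ring

lemma integral_one_sub_div_two_div_sqrt :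
    ∫ m in (-1 : ℝ)..1, (1 - m) / 2 / Real.sqrt (1 - m) = 2 * Real.sqrt 2 / 3 := by
  simp only [one_sub_div_two_div_sqrt, intervalIntegral.integral_const_mul, integral_sqrt_one_sub]
  ring

lemma integral_one_add_div_two_div_sqrt :
    ∫ m in (-1 : ℝ)..1, (1 + m) / 2 / Real.sqrt (1 - m) = 4 * Real.sqrt 2 / 3 := by
  have h (m : ℝ) : (1 + m) / 2 / Real.sqrt (1 - m) =
      1 / Real.sqrt (1 - m) - 1 / 2 * Real.sqrt (1 - m) := by
    rw [← one_sub_div_two_div_sqrt]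
    ring
  have hi : IntervalIntegrable (fun m : ℝ => 1 / 2 * Real.sqrt (1 - m)) volume (-1) 1 :=
    Continuous.intervalIntegrable (by fun_prop) _ _
  simp only [h]
  rw [intervalIntegral.integral_sub intervalIntegrable_one_div_sqrt_one_sub hi,
    intervalIntegral.integral_const_mul, integral_one_div_sqrt_one_sub, integral_sqrt_one_sub]
  ring

/-- Differentiation under the integral sign, at the diagonal point, along a convex weight `b`. -/
lemma hasDerivAt_integral_eval_div_sqrt (p : Polynomial ℝ) (b : ℝ → ℝ) (hb : Continuous b)
    (hb01 : ∀ m ∈ Set.Ioc (-1 : ℝ) 1, |b m| ≤ 1) (u : ℝ) :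
    HasDerivAt (fun x => ∫ m in (-1 : ℝ)..1, p.eval (u + b m * (x - u)) / Real.sqrt (1 - m))
      (p.derivative.eval u * ∫ m in (-1 : ℝ)..1, b m / Real.sqrt (1 - m)) u := by
  obtain ⟨C, hC⟩ := (isCompact_closedBall u 1).exists_bound_of_continuousOn
    (Polynomial.continuous p.derivative).continuousOn
  have hmeas {g : ℝ → ℝ} (hg : Continuous g) :
      AEStronglyMeasurable (fun m => g m / Real.sqrt (1 - m))
        (volume.restrict (Set.uIoc (-1) 1)) :=
    Measurable.aestronglyMeasurable (by fun_prop)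
  have key := intervalIntegral.hasDerivAt_integral_of_dominated_loc_of_deriv_le (μ := volume)
    (a := -1) (b := 1) (x₀ := u) (s := Metric.ball u 1)
    (F := fun x m => p.eval (u + b m * (x - u)) / Real.sqrt (1 - m))
    (F' := fun x m => p.derivative.eval (u + b m * (x - u)) * b m / Real.sqrt (1 - m))
    (bound := fun m => C * (1 / Real.sqrt (1 - m)))
    (Metric.ball_mem_nhds u one_pos)
    (Filter.Eventually.of_forall fun x => hmeas
      (p.continuous.comp (by fun_prop : Continuous fun m => u + b m * (x - u))))
    (by simpa [div_eq_mul_inv] using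
      intervalIntegrable_one_div_sqrt_one_sub.const_mul (p.eval u))
    (hmeas ((p.derivative.continuous.comp
      (by fun_prop : Continuous fun m => u + b m * (u - u))).mul hb))
    (Filter.Eventually.of_forall fun m hm x hx => ?_)
    (intervalIntegrable_one_div_sqrt_one_sub.const_mul C)
    (Filter.Eventually.of_forall fun m _ x _ => ?_)
  · refine key.2.congr_deriv ?_
    simp [mul_div_assoc]
  · rw [Set.uIoc_of_le (by norm_num)] at hm
    have hbm := hb01 m hm
    have hmem : u + b m * (x - u) ∈ Metric.closedBall u 1 := by
      rw [Metric.mem_ball, Real.dist_eq] at hx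
      rw [Metric.mem_closedBall, Real.dist_eq, add_sub_cancel_left, abs_mul]
      exact mul_le_one₀ hbm (abs_nonneg _) hx.le
    have h := hC _ hmem
    rw [norm_div, norm_mul, Real.norm_of_nonneg (Real.sqrt_nonneg _), mul_one_div]
    gcongr
    exact (mul_le_mul h hbm (abs_nonneg _) ((norm_nonneg _).trans h)).trans_eq (mul_one C)
  · have h1 : HasDerivAt (fun x => u + b m * (x - u)) (b m) x := by
      simpa using (((hasDerivAt_id x).sub_const u).const_mul (b m)).const_add u
    exact ((p.hasDerivAt _).comp x h1).div_const _

/-- For polynomial f: (i) (∂_u q_f + ∂_v q_f)(u,u) = f'(u); (ii) (∂_u q_f)(u,u) = f'(u)/3.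
    Consequently in the limit v → u the trailing-edge equation 6t + ∂_v q + ∂_u q = 0 and
    the leading-edge equation 2t + ∂_u q = 0 both reduce to 6t + f'(u) = 0. -/
theorem stmt9 (f : ℝ → ℝ) (hpoly : ∃ p : Polynomial ℝ, ∀ x, f x = p.eval x) (u : ℝ) :
    deriv (fun a => qf f a u) u + deriv (fun b => qf f u b) u = deriv f u ∧
    deriv (fun a => qf f a u) u = deriv f u / 3 ∧
    (∀ t : ℝ,
      (6 * t + deriv (fun b => qf f u b) u + deriv (fun a => qf f a u) u = 0 ↔
        6 * t + deriv f u = 0)) ∧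
    (∀ t : ℝ, (2 * t + deriv (fun a => qf f a u) u = 0 ↔ 6 * t + deriv f u = 0)) := by
  obtain ⟨p, hp⟩ := hpoly
  obtain rfl : f = fun x => p.eval x := funext hp
  have hs : Real.sqrt 2 ≠ 0 := by positivity
  have hf : deriv (fun x => p.eval x) u = p.derivative.eval u := p.deriv
  have hu : deriv (fun a => qf (fun x => p.eval x) a u) u = p.derivative.eval u / 3 := by
    have h := (hasDerivAt_integral_eval_div_sqrt p (fun m => (1 - m) / 2) (by fun_prop)
      (fun m hm => abs_le.2 ⟨by linarith [hm.2], by linarith [hm.1]⟩) u).const_mul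
      (1 / (2 * Real.sqrt 2))
    rw [integral_one_sub_div_two_div_sqrt] at h
    have e : (fun a => qf (fun x => p.eval x) a u) = fun a => 1 / (2 * Real.sqrt 2) *
        ∫ m in (-1 : ℝ)..1, p.eval (u + (1 - m) / 2 * (a - u)) / Real.sqrt (1 - m) := by
      funext a
      unfold qf
      congr! 5
      ring
    rw [e, h.deriv]
    field_simp
  have hv : deriv (fun b => qf (fun x => p.eval x) u b) u = 2 * p.derivative.eval u / 3 := by
    have h := (hasDerivAt_integral_eval_div_sqrt p (fun m => (1 + m) / 2) (by fun_prop)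
      (fun m hm => abs_le.2 ⟨by linarith [hm.1], by linarith [hm.2]⟩) u).const_mul
      (1 / (2 * Real.sqrt 2))
    rw [integral_one_add_div_two_div_sqrt] at h
    have e : (fun b => qf (fun x => p.eval x) u b) = fun b => 1 / (2 * Real.sqrt 2) *
        ∫ m in (-1 : ℝ)..1, p.eval (u + (1 + m) / 2 * (b - u)) / Real.sqrt (1 - m) := by
      funext b
      unfold qf
      congr! 5
      ring
    rw [e, h.deriv]
    field_simp
    ring
  rw [hu, hv, hf]
  refine ⟨by ring, rfl, fun t => ?_, fun t => ?_⟩ <;> constructor <;> intro h <;> linarith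
end

section
/- Let c be a real number with −√15/2 < c < −√(10/3), set u₁ := −(3/10)(c − √(c² − 10/3)) and t₁ := (1/6)(3 u₁² + 4 c u₁³ + 5 u₁⁴), and let q_c(u,v) = −(1/35)(5u³ + 6u²v + 8uv² + 16v³) − (c/315)(35u⁴ + 40u³v + 48u²v² + 64uv³ + 128v⁴) − (1/693)(63u⁵ + 70u⁴v + 80u³v² + 96u²v³ + 128uv⁴ + 256v⁵). Then the two conditions (a) 6 t₁ + ∂_v q_c(u₁,v) + ∂_u q_c(u₁,v) ≤ 0 for all v ∈ ℝ, and (b) 2 t₁ + ∂_u q_c(u₁,v) ≤ 0 for all v ∈ ℝ, hold simultaneously if and only if c ≤ ν₁, where ν₁ = −(1/6)√(5(13 + 5√7)). -/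
theorem deriv_qc_left (c u v : ℝ) :
    deriv (fun a => qc c a v) u =
      -(1 / 35) * (15 * u ^ 2 + 12 * u * v + 8 * v ^ 2) -
        c / 315 * (140 * u ^ 3 + 120 * u ^ 2 * v + 96 * u * v ^ 2 + 64 * v ^ 3) -
        1 / 693 * (315 * u ^ 4 + 280 * u ^ 3 * v + 240 * u ^ 2 * v ^ 2 + 192 * u * v ^ 3 +
          128 * v ^ 4) := by
  have h1 := hasDerivAt_id' u
  have h := ((((((h1.pow 3).const_mul 5).add (((h1.pow 2).const_mul 6).mul_const v)).add
    ((h1.const_mul 8).mul_const (v ^ 2))).add_const (16 * v ^ 3)).const_mul (-(1 / 35))).sub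
    ((((((h1.pow 4).const_mul 35).add (((h1.pow 3).const_mul 40).mul_const v)).add
      (((h1.pow 2).const_mul 48).mul_const (v ^ 2))).add
      ((h1.const_mul 64).mul_const (v ^ 3))).add_const (128 * v ^ 4) |>.const_mul (c / 315))
    |>.sub
    (((((((h1.pow 5).const_mul 63).add (((h1.pow 4).const_mul 70).mul_const v)).add
      (((h1.pow 3).const_mul 80).mul_const (v ^ 2))).add
      (((h1.pow 2).const_mul 96).mul_const (v ^ 3))).add
      ((h1.const_mul 128).mul_const (v ^ 4))).add_const (256 * v ^ 5) |>.const_mul (1 / 693))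
  refine (h.congr_deriv ?_).deriv
  norm_num
  ring

theorem deriv_qc_right (c u v : ℝ) :
    deriv (fun b => qc c u b) v =
      -(1 / 35) * (6 * u ^ 2 + 16 * u * v + 48 * v ^ 2) -
        c / 315 * (40 * u ^ 3 + 96 * u ^ 2 * v + 192 * u * v ^ 2 + 512 * v ^ 3) -
        1 / 693 * (70 * u ^ 4 + 160 * u ^ 3 * v + 288 * u ^ 2 * v ^ 2 + 512 * u * v ^ 3 +
          1280 * v ^ 4) := by
  have h1 := hasDerivAt_id' v
  have h := (((((h1.const_mul (6 * u ^ 2)).const_add (5 * u ^ 3)).add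
    ((h1.pow 2).const_mul (8 * u))).add ((h1.pow 3).const_mul 16)).const_mul (-(1 / 35))).sub
    ((((((h1.const_mul (40 * u ^ 3)).const_add (35 * u ^ 4)).add
      ((h1.pow 2).const_mul (48 * u ^ 2))).add ((h1.pow 3).const_mul (64 * u))).add
      ((h1.pow 4).const_mul 128)).const_mul (c / 315))
    |>.sub
    (((((((h1.const_mul (70 * u ^ 4)).const_add (63 * u ^ 5)).add
      ((h1.pow 2).const_mul (80 * u ^ 3))).add ((h1.pow 3).const_mul (96 * u ^ 2))).add
      ((h1.pow 4).const_mul (128 * u))).add ((h1.pow 5).const_mul 256)).const_mul (1 / 693))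
  refine (h.congr_deriv ?_).deriv
  norm_num
  ring

/-- At an inflection point `u` of `f_c`, the expression in (a) factors after rescaling `v = u w`. -/
theorem sum_derivs_qc_factor {c u t : ℝ} (h : 10 * u ^ 2 + 6 * c * u + 3 = 0)
    (ht : t = (1 / 6) * (3 * u ^ 2 + 4 * c * u ^ 3 + 5 * u ^ 4)) (w : ℝ) :
    6 * t + deriv (fun b => qc c u b) (u * w) + deriv (fun a => qc c a (u * w)) u =
      -(8 / 315) * (u * (w - 1)) ^ 2 *
        (10 * u ^ 2 * (8 * w ^ 2 + 8 * w + 5) - 9 * (4 * w + 3)) := by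
  rw [deriv_qc_left, deriv_qc_right, ht]
  linear_combination
    (u ^ 2 * (4 - (1 / 315) * (180 + 216 * w + 288 * w ^ 2 + 576 * w ^ 3)) / 6) * h

/-- At an inflection point `u` of `f_c`, the expression in (b) factors after rescaling `v = u w`. -/
theorem deriv_qc_left_factor {c u t : ℝ} (h : 10 * u ^ 2 + 6 * c * u + 3 = 0)
    (ht : t = (1 / 6) * (3 * u ^ 2 + 4 * c * u ^ 3 + 5 * u ^ 4)) (w : ℝ) :
    2 * t + deriv (fun a => qc c a (u * w)) u =
      -(8 / 10395) * (u * (w - 1)) ^ 2 *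
        (10 * u ^ 2 * (24 * w ^ 2 + 40 * w + 35) - 33 * (4 * w + 5)) := by
  rw [deriv_qc_left, ht]
  linear_combination
    (u ^ 2 * (4 / 3 - (1 / 315) * (140 + 120 * w + 96 * w ^ 2 + 64 * w ^ 3)) / 6) * h

/-- Both conditions hold simultaneously iff the quadratic factor in (a) has nonpositive
discriminant. -/
theorem conditions_iff_discrim {c u t : ℝ} (h : 10 * u ^ 2 + 6 * c * u + 3 = 0)
    (ht : t = (1 / 6) * (3 * u ^ 2 + 4 * c * u ^ 3 + 5 * u ^ 4)) (hu : 3 / 10 < u ^ 2) :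
    ((∀ v : ℝ, 6 * t + deriv (fun b => qc c u b) v + deriv (fun a => qc c a v) u ≤ 0) ∧
      (∀ v : ℝ, 2 * t + deriv (fun a => qc c a v) u ≤ 0)) ↔
    0 ≤ 200 * (u ^ 2) ^ 2 - 60 * u ^ 2 - 27 := by
  have hu0 : u ≠ 0 := by
    rintro rfl
    norm_num at hu
  constructor
  · rintro ⟨ha, -⟩
    by_contra! hneg
    obtain ⟨w, hw⟩ : ∃ w : ℝ, 160 * u ^ 2 * w = 36 - 80 * u ^ 2 :=
      ⟨(36 - 80 * u ^ 2) / (160 * u ^ 2), by field_simp⟩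
    have hw1 : w - 1 ≠ 0 := by
      intro hw1
      obtain rfl : w = 1 := by linarith
      linarith
    have hsq : 0 < (u * (w - 1)) ^ 2 := by positivity
    have key := ha (u * w)
    rw [sum_derivs_qc_factor h ht] at key
    have hR : 0 ≤ 10 * u ^ 2 * (8 * w ^ 2 + 8 * w + 5) - 9 * (4 * w + 3) := by
      by_contra! hR
      nlinarith [mul_pos_of_neg_of_neg hR (neg_neg_of_pos hsq)]
    have hid : 320 * u ^ 2 * (10 * u ^ 2 * (8 * w ^ 2 + 8 * w + 5) - 9 * (4 * w + 3)) =
        48 * (200 * (u ^ 2) ^ 2 - 60 * u ^ 2 - 27) := by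
      linear_combination (160 * u ^ 2 * w + 80 * u ^ 2 - 36) * hw
    nlinarith [mul_nonneg (by positivity : 0 ≤ 320 * u ^ 2) hR]
  · intro hk
    have hs : 0 < u ^ 2 := by positivity
    refine ⟨fun v => ?_, fun v => ?_⟩
    all_goals obtain ⟨w, rfl⟩ : ∃ w, v = u * w := ⟨v / u, by field_simp⟩
    · rw [sum_derivs_qc_factor h ht]
      have hR : 0 ≤ 10 * u ^ 2 * (8 * w ^ 2 + 8 * w + 5) - 9 * (4 * w + 3) := by
        refine nonneg_of_mul_nonneg_right (a := 320 * u ^ 2) ?_ (by positivity)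
        linear_combination 48 * hk + sq_nonneg (160 * u ^ 2 * w + 80 * u ^ 2 - 36)
      nlinarith [mul_nonneg (sq_nonneg (u * (w - 1))) hR]
    · rw [deriv_qc_left_factor h ht]
      have hS : 0 ≤ 10 * u ^ 2 * (24 * w ^ 2 + 40 * w + 35) - 33 * (4 * w + 5) := by
        refine nonneg_of_mul_nonneg_right (a := 960 * u ^ 2) ?_ (by positivity)
        linear_combination 880 * hk + sq_nonneg (480 * u ^ 2 * w + 400 * u ^ 2 - 132)
      nlinarith [mul_nonneg (sq_nonneg (u * (w - 1))) hS]

theorem discrim_nonneg_iff {s : ℝ} (hs : 3 / 10 < s) :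
    0 ≤ 200 * s ^ 2 - 60 * s - 27 ↔ 3 / 20 * (1 + √7) ≤ s := by
  have h7 : √7 ^ 2 = 7 := Real.sq_sqrt (by norm_num)
  have hpos : 0 < 200 * (s - 3 / 20 * (1 - √7)) := by
    linarith [Real.sqrt_nonneg 7]
  have hfac : 200 * s ^ 2 - 60 * s - 27 =
      200 * (s - 3 / 20 * (1 - √7)) * (s - 3 / 20 * (1 + √7)) := by
    linear_combination (9 / 2) * h7
  rw [hfac, mul_nonneg_iff_of_pos_left hpos, sub_nonneg]

theorem le_threshold_iff {c u : ℝ} (h : 10 * u ^ 2 + 6 * c * u + 3 = 0) (hc : c < 0)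
    (hu : 3 / 10 < u ^ 2) :
    c ≤ -(1 / 6) * √(5 * (13 + 5 * √7)) ↔ 3 / 20 * (1 + √7) ≤ u ^ 2 := by
  have h7 : √7 ^ 2 = 7 := Real.sq_sqrt (by norm_num)
  have h73 : √7 < 3 := by
    rw [Real.sqrt_lt' (by norm_num)]
    norm_num
  have hsq : c ≤ -(1 / 6) * √(5 * (13 + 5 * √7)) ↔ 5 * (13 + 5 * √7) ≤ 36 * c ^ 2 := by
    rw [show 36 * c ^ 2 = (-6 * c) ^ 2 by ring, ← Real.sqrt_le_left (by linarith)]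
    constructor <;> intro h <;> linarith
  have hpos : 0 < 100 * u ^ 2 - 10 * (√7 - 1) := by linarith
  have hfac : u ^ 2 * (36 * c ^ 2 - 5 * (13 + 5 * √7)) =
      (100 * u ^ 2 - 10 * (√7 - 1)) * (u ^ 2 - 3 / 20 * (1 + √7)) := by
    linear_combination (6 * c * u - 10 * u ^ 2 - 3) * h - (3 / 2) * h7
  rw [hsq, ← sub_nonneg, ← mul_nonneg_iff_of_pos_left (by linarith : 0 < u ^ 2), hfac,
    mul_nonneg_iff_of_pos_left hpos, sub_nonneg]

/-- For −√15/2 < c < −√(10/3) and the second breaking point (u₁,t₁), the conditions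
    (a) 6t₁ + ∂_v q_c(u₁,v) + ∂_u q_c(u₁,v) ≤ 0 for all v and
    (b) 2t₁ + ∂_u q_c(u₁,v) ≤ 0 for all v
    hold simultaneously iff c ≤ ν₁ = −(1/6)√(5(13 + 5√7)). -/
theorem stmt11 (c : ℝ) (hc1 : -(Real.sqrt 15 / 2) < c) (hc2 : c < -Real.sqrt (10 / 3))
    (u₁ t₁ : ℝ) (hu : u₁ = -(3 / 10) * (c - Real.sqrt (c ^ 2 - 10 / 3)))
    (ht : t₁ = (1 / 6) * (3 * u₁ ^ 2 + 4 * c * u₁ ^ 3 + 5 * u₁ ^ 4)) :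
    ((∀ v : ℝ, 6 * t₁ + deriv (fun b => qc c u₁ b) v + deriv (fun a => qc c a v) u₁ ≤ 0) ∧
      (∀ v : ℝ, 2 * t₁ + deriv (fun a => qc c a v) u₁ ≤ 0)) ↔
    c ≤ -(1 / 6) * Real.sqrt (5 * (13 + 5 * Real.sqrt 7)) := by
  have hpos : 0 < √(10 / 3 : ℝ) := by positivity
  have hc : c < 0 := by linarith
  have hcsq : 10 / 3 < c ^ 2 := by
    rw [← neg_sq, ← Real.sqrt_lt' (by linarith)]
    linarith
  have hd : √(c ^ 2 - 10 / 3) ^ 2 = c ^ 2 - 10 / 3 := Real.sq_sqrt (by linarith)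
  have hcrit : 10 * u₁ ^ 2 + 6 * c * u₁ + 3 = 0 := by
    rw [hu]
    linear_combination (9 / 10) * hd
  have hu1 : 3 / 10 < u₁ ^ 2 := by
    rw [hu]
    nlinarith [Real.sqrt_nonneg (c ^ 2 - 10 / 3),
      mul_nonneg (neg_nonneg.2 hc.le) (Real.sqrt_nonneg (c ^ 2 - 10 / 3))]
  rw [conditions_iff_discrim hcrit ht hu1, discrim_nonneg_iff hu1, le_threshold_iff hcrit hc hu1]
end

section
/- Let c be a real number with ν₄ < c ≤ √15/2, where ν₄ = √((75 + 21√15)/44), and let q_c(u,v) = −(1/35)(5u³ + 6u²v + 8uv² + 16v³) − (c/315)(35u⁴ + 40u³v + 48u²v² + 64uv³ + 128v⁴) − (1/693)(63u⁵ + 70u⁴v + 80u³v² + 96u²v³ + 128uv⁴ + 256v⁵). Then there exist t > 0, u ∈ ℝ and two distinct points v > u and w > u, v ≠ w, such that, writing L(z) := 2t + ∂_u q_c(u,z), both z = v and z = w satisfy L(z) = 0, L'(z) = 0 and L''(z) < 0. That is, for these values of c the solution of the Whitham equations possesses a double leading edge. -/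
/-- The trailing-edge polynomial P(z) = 6t + ∂_v q_c(u,z) + ∂_u q_c(u,z). -/
noncomputable def Ptrail (c t u : ℝ) : ℝ → ℝ := fun z =>
  6 * t + deriv (fun b => qc c u b) z + deriv (fun a => qc c a z) u

/-- The leading-edge polynomial L(z) = 2t + ∂_u q_c(u,z). -/
noncomputable def Llead (c t u : ℝ) : ℝ → ℝ := fun z =>
  2 * t + deriv (fun a => qc c a z) u

/-- ν₄ = √((75 + 21√15)/44). -/
noncomputable def nu4 : ℝ := Real.sqrt ((75 + 21 * Real.sqrt 15) / 44)

theorem hasDerivAt_qc_left (c z u : ℝ) :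
    HasDerivAt (fun a => qc c a z)
      (-(1 / 35) * (15 * u ^ 2 + 12 * u * z + 8 * z ^ 2) -
        c / 315 * (140 * u ^ 3 + 120 * u ^ 2 * z + 96 * u * z ^ 2 + 64 * z ^ 3) -
        1 / 693 * (315 * u ^ 4 + 280 * u ^ 3 * z + 240 * u ^ 2 * z ^ 2 + 192 * u * z ^ 3 +
          128 * z ^ 4)) u := by
  have h1 := hasDerivAt_id' u
  have h2 := hasDerivAt_pow 2 u
  have h3 := hasDerivAt_pow 3 u
  have h4 := hasDerivAt_pow 4 u
  have h5 := hasDerivAt_pow 5 u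
  have hA := ((((h3.const_mul 5).add ((h2.const_mul 6).mul_const z)).add
    ((h1.const_mul 8).mul_const (z ^ 2))).add_const (16 * z ^ 3)).const_mul (-(1 / 35))
  have hB := (((((h4.const_mul 35).add ((h3.const_mul 40).mul_const z)).add
    ((h2.const_mul 48).mul_const (z ^ 2))).add
    ((h1.const_mul 64).mul_const (z ^ 3))).add_const (128 * z ^ 4)).const_mul (c / 315)
  have hC := ((((((h5.const_mul 63).add ((h4.const_mul 70).mul_const z)).add
    ((h3.const_mul 80).mul_const (z ^ 2))).add
    ((h2.const_mul 96).mul_const (z ^ 3))).add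
    ((h1.const_mul 128).mul_const (z ^ 4))).add_const (256 * z ^ 5)).const_mul (1 / 693)
  refine HasDerivAt.congr_deriv (f' := _) ((hA.sub hB).sub hC) ?_
  norm_num
  ring

/-- The second derivative of a multiple of the square of a monic quadratic, at a zero of the
quadratic. -/
theorem deriv_deriv_const_mul_sq_quadratic {k α β z : ℝ} (hz : z ^ 2 + α * z + β = 0) :
    deriv (fun z : ℝ => k * (z ^ 2 + α * z + β) ^ 2) z = 0 ∧
      deriv (deriv (fun z : ℝ => k * (z ^ 2 + α * z + β) ^ 2)) z =
        2 * k * (2 * z + α) ^ 2 := by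
  have hq (x : ℝ) : HasDerivAt (fun z : ℝ => z ^ 2 + α * z + β) (2 * x + α) x := by
    refine HasDerivAt.congr_deriv
      (((hasDerivAt_pow 2 x).add ((hasDerivAt_id' x).const_mul α)).add_const β) ?_
    norm_num
  have hl (x : ℝ) : HasDerivAt (fun z : ℝ => 2 * z + α) 2 x := by
    simpa using ((hasDerivAt_id' x).const_mul 2).add_const α
  have h1 : deriv (fun z : ℝ => k * (z ^ 2 + α * z + β) ^ 2) =
      fun z => 2 * k * ((z ^ 2 + α * z + β) * (2 * z + α)) := by
    funext x
    refine (HasDerivAt.congr_deriv (((hq x).pow 2).const_mul k) ?_).deriv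
    norm_num
    ring
  rw [h1]
  refine ⟨by simp [hz], ?_⟩
  refine (HasDerivAt.congr_deriv (((hq z).mul (hl z)).const_mul (2 * k)) ?_).deriv
  rw [hz]
  ring

/-- The cubic whose roots, shifted by `-c/5`, are the values of `u` for which the quartic
`Llead c t u` is, for a suitable `t`, a multiple of the square of a quadratic. -/
theorem exists_root_double_edge_cubic {c : ℝ} (hc0 : 0 < c)
    (hc1 : 88 * c ^ 4 - 300 * c ^ 2 - 45 > 0) (hc2 : c ^ 2 ≤ 15 / 4) (hc3 : 5 / 2 < c ^ 2) :
    ∃ s : ℝ, s < 0 ∧ 18 / 175 * (c ^ 2 - 5 / 2) < s ^ 2 ∧ s ^ 2 < 12 / 25 * (c ^ 2 - 5 / 2) ∧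
      s ^ 3 - 54 / 175 * (c ^ 2 - 5 / 2) * s + 24 / 125 * c * (c ^ 2 - 15 / 4) = 0 := by
  have hk : 0 < c ^ 2 - 5 / 2 := by linarith
  set f : ℝ → ℝ := fun s =>
    s ^ 3 - 54 / 175 * (c ^ 2 - 5 / 2) * s + 24 / 125 * c * (c ^ 2 - 15 / 4) with hf
  obtain ⟨m, hm, hm2⟩ : ∃ m : ℝ, 0 < m ∧ m ^ 2 = 18 / 175 * (c ^ 2 - 5 / 2) :=
    ⟨√(18 / 175 * (c ^ 2 - 5 / 2)), by positivity, Real.sq_sqrt (by positivity)⟩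
  obtain ⟨M, hM, hM2⟩ : ∃ M : ℝ, 0 < M ∧ M ^ 2 = 12 / 25 * (c ^ 2 - 5 / 2) :=
    ⟨√(12 / 25 * (c ^ 2 - 5 / 2)), by positivity, Real.sq_sqrt (by positivity)⟩
  have hmM : m < M := by
    apply lt_of_pow_lt_pow_left₀ 2 hM.le
    rw [hm2, hM2]
    linarith
  have hfM : f (-M) < 0 := by
    have h1 : f (-M) = -(6 / 35 * (c ^ 2 - 5 / 2) * M) - 24 / 125 * c * (15 / 4 - c ^ 2) := by
      simp only [hf]
      linear_combination (-M) * hM2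
    have h2 : 0 < (c ^ 2 - 5 / 2) * M := mul_pos hk hM
    have h3 : 0 ≤ c * (15 / 4 - c ^ 2) := mul_nonneg hc0.le (by linarith)
    rw [h1]
    linarith
  have hfm : 0 < f (-m) := by
    have h1 : f (-m) = 2 * m ^ 3 - 24 / 125 * c * (15 / 4 - c ^ 2) := by
      simp only [hf]
      linear_combination (-3 * m) * hm2
    have h2 : 24 / 125 * c * (15 / 4 - c ^ 2) < 2 * m ^ 3 := by
      apply lt_of_pow_lt_pow_left₀ 2 (by positivity)
      have h3 : (2 * m ^ 3) ^ 2 = 4 * (18 / 175 * (c ^ 2 - 5 / 2)) ^ 3 := by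
        rw [← hm2]
        ring
      have h4 : 0 < (225 / 8 - 55 / 8 * c ^ 2) * (88 * c ^ 4 - 300 * c ^ 2 - 45) :=
        mul_pos (by linarith) hc1
      rw [h3]
      linarith
    rw [h1]
    linarith
  obtain ⟨s, ⟨hs1, hs2⟩, hs⟩ := intermediate_value_Ioo (neg_le_neg hmM.le)
    (f := f) (by fun_prop) ⟨hfM, hfm⟩
  refine ⟨s, by linarith, ?_, ?_, hs⟩
  · rw [← hm2]
    nlinarith
  · rw [← hM2]
    nlinarith

/-- A bound on `β ^ 2`, which yields positivity of the time of a double leading edge. -/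
theorem sq_lt_quartic_of_double_edge {c s u β : ℝ} (hcl : 188 / 100 < c) (hcu : c < 194 / 100)
    (hc2 : c ^ 2 ≤ 15 / 4) (hsl : -(78 / 100) < s) (hsu : s < -(32 / 100))
    (hu : u = s - c / 5)
    (hβ : β = 21 / 32 * s ^ 2 + 3 / 20 * c * s - 83 / 400 * c ^ 2 + 99 / 160) :
    β ^ 2 < 315 / 128 * u ^ 4 + 77 / 32 * c * u ^ 3 + 297 / 128 * u ^ 2 := by
  have hu1 : u < -(68 / 100) := by linarith
  have hu2 : 46 / 100 < u ^ 2 := by nlinarith only [hu1]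
  have hs2u : s ^ 2 < 6084 / 10000 := by nlinarith only [hsl, hsu]
  have hc2l : 35344 / 10000 < c ^ 2 := by nlinarith only [hcl]
  have hcs : 194 / 100 * s < c * s := by nlinarith only [hcu, hsu]
  have hcs' : c * s < 188 / 100 * s := by nlinarith only [hcl, hsu]
  have hβl : -(2 / 10) < β := by
    nlinarith only [hβ, hcs, hc2, sq_nonneg (s + 32 / 100), hsu]
  have hβu : β < 2 / 10 := by nlinarith only [hβ, hcs', hc2l, hs2u, hsu]
  have hβ2 : β ^ 2 < 4 / 100 + 1 / 1000 := by nlinarith only [hβl, hβu]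
  have hquad : 1 / 10 ≤ 315 / 128 * u ^ 2 + 77 / 32 * c * u + 297 / 128 := by
    nlinarith only [hc2, sq_nonneg (u + 22 / 45 * c)]
  have h := mul_le_mul_of_nonneg_left hquad (sq_nonneg u)
  linarith

/-- For ν₄ < c ≤ √15/2 the Whitham solution possesses a double leading edge: there are
    t > 0, u and two distinct points v > u, w > u that are simultaneously zeros and local
    maxima of the quartic L(z) = 2t + ∂_u q_c(u,z). -/
theorem stmt13 (c : ℝ) (hc1 : nu4 < c) (hc2 : c ≤ Real.sqrt 15 / 2) :
    ∃ t u v w : ℝ, 0 < t ∧ u < v ∧ u < w ∧ v ≠ w ∧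
      Llead c t u v = 0 ∧ deriv (Llead c t u) v = 0 ∧ deriv (deriv (Llead c t u)) v < 0 ∧
      Llead c t u w = 0 ∧ deriv (Llead c t u) w = 0 ∧
      deriv (deriv (Llead c t u)) w < 0 := by
  have h15 : √15 ^ 2 = 15 := Real.sq_sqrt (by norm_num)
  have hr : 0 ≤ √15 := Real.sqrt_nonneg _
  have hr1 : 387 / 100 < √15 := Real.lt_sqrt_of_sq_lt (by norm_num)
  have hc0 : 0 < c := (Real.sqrt_nonneg _).trans_lt hc1
  have hx1 : (75 + 21 * √15) / 44 < c ^ 2 := (Real.sqrt_lt' hc0).1 hc1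
  have hx2 : c ^ 2 ≤ 15 / 4 := by nlinarith
  have hx3 : 355 / 100 < c ^ 2 := by linarith
  have hx4 : 88 * c ^ 4 - 300 * c ^ 2 - 45 > 0 := by nlinarith
  obtain ⟨s, hs0, hs1, hs2, hs⟩ := exists_root_double_edge_cubic hc0 hx4 hx2 (by linarith)
  have hcl : 188 / 100 < c := by nlinarith
  have hcu : c < 194 / 100 := by nlinarith
  have hsl : -(78 / 100) < s := by nlinarith
  have hsu : s < -(32 / 100) := by nlinarith
  obtain ⟨u, hu⟩ : ∃ u, u = s - c / 5 := ⟨_, rfl⟩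
  obtain ⟨α, hα⟩ : ∃ α, α = 3 / 4 * s + 2 / 5 * c := ⟨_, rfl⟩
  obtain ⟨β, hβ⟩ : ∃ β, β = 21 / 32 * s ^ 2 + 3 / 20 * c * s - 83 / 400 * c ^ 2 + 99 / 160 :=
    ⟨_, rfl⟩
  obtain ⟨t, ht⟩ : ∃ t, 693 / 64 * t =
      315 / 128 * u ^ 4 + 77 / 32 * c * u ^ 3 + 297 / 128 * u ^ 2 - β ^ 2 :=
    ⟨64 / 693 * (315 / 128 * u ^ 4 + 77 / 32 * c * u ^ 3 + 297 / 128 * u ^ 2 - β ^ 2), by ring⟩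
  have hL : Llead c t u = fun z => -(128 / 693) * (z ^ 2 + α * z + β) ^ 2 := by
    funext z
    rw [Llead, (hasDerivAt_qc_left c z u).deriv]
    have hcub : 2 * α * β = 35 / 16 * u ^ 3 + 33 / 16 * c * u ^ 2 + 297 / 160 * u := by
      rw [hα, hβ, hu]
      linear_combination (-(77 / 64)) * hs
    have h2t : 2 * t = 128 / 693 *
        (315 / 128 * u ^ 4 + 77 / 32 * c * u ^ 3 + 297 / 128 * u ^ 2 - β ^ 2) := by
      rw [← ht]
      ring
    rw [h2t]
    have h3 : 2 * α = 3 / 2 * u + 11 / 10 * c := by rw [hα, hu]; ring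
    have h4 : α ^ 2 + 2 * β = 15 / 8 * u ^ 2 + 33 / 20 * c * u + 99 / 80 := by
      rw [hα, hβ, hu]; ring
    linear_combination (128 / 693 * z) * hcub + (128 / 693 * z ^ 3) * h3 +
      (128 / 693 * z ^ 2) * h4
  have hD : 0 < α ^ 2 - 4 * β := by
    rw [hα, hβ]
    linarith
  obtain ⟨d, hd, hd2⟩ : ∃ d : ℝ, 0 < d ∧ d ^ 2 = α ^ 2 - 4 * β :=
    ⟨√(α ^ 2 - 4 * β), Real.sqrt_pos.2 hD, Real.sq_sqrt hD.le⟩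
  have hdu : d < -α - 2 * u := by
    apply lt_of_pow_lt_pow_left₀ 2 (by linarith)
    rw [hd2, hα, hβ, hu]
    linarith
  have ht0 : 0 < t := by
    have := sq_lt_quartic_of_double_edge hcl hcu hx2 hsl hsu hu hβ
    linarith
  have hv : ((-α + d) / 2) ^ 2 + α * ((-α + d) / 2) + β = 0 := by linear_combination hd2 / 4
  have hw : ((-α - d) / 2) ^ 2 + α * ((-α - d) / 2) + β = 0 := by linear_combination hd2 / 4
  obtain ⟨hv1, hv2⟩ := deriv_deriv_const_mul_sq_quadratic (k := -(128 / 693)) hv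
  obtain ⟨hw1, hw2⟩ := deriv_deriv_const_mul_sq_quadratic (k := -(128 / 693)) hw
  refine ⟨t, u, (-α + d) / 2, (-α - d) / 2, ht0, by linarith, by linarith,
    fun h => by linarith, ?_⟩
  rw [hL]
  refine ⟨by simp [hv], hv1, ?_, by simp [hw], hw1, ?_⟩
  · rw [hv2]
    nlinarith only [mul_pos hd hd]
  · rw [hw2]
    nlinarith only [mul_pos hd hd]
end

section
/- Let u₁ > u₂ > u₃ be real numbers and define α₀(u₁,u₂,u₃) := −( ∫_{u₃}^{u₂} r / √((r−u₁)(r−u₂)(r−u₃)) dr ) / ( ∫_{u₃}^{u₂} 1 / √((r−u₁)(r−u₂)(r−u₃)) dr ). Then for each i ∈ {1,2,3} the function α₀ is differentiable with respect to u_i and ∂α₀/∂u_i = −1/2 + (1/2)·(α₀ + u_i)² / ∏_{j≠i}(u_i − u_j). -/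
open MeasureTheory intervalIntegral

/-- α₀(u₁,u₂,u₃) = −(∫_{u₃}^{u₂} r/√((r−u₁)(r−u₂)(r−u₃)) dr)
                    /(∫_{u₃}^{u₂} 1/√((r−u₁)(r−u₂)(r−u₃)) dr). -/
noncomputable def alpha0 (u₁ u₂ u₃ : ℝ) : ℝ :=
  -(∫ r in u₃..u₂, r / Real.sqrt ((r - u₁) * (r - u₂) * (r - u₃))) /
    ∫ r in u₃..u₂, (1 : ℝ) / Real.sqrt ((r - u₁) * (r - u₂) * (r - u₃))

open Set Filter Topology

/-- Differentiation under the integral sign of `t ↦ ∫ g (x θ + (t - t₀) y θ) dθ` at `t₀`, when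
`x` is positive and `g` is continuously differentiable on the positive half-line. -/
theorem hasDerivAt_integral_comp_affine {g g' x y : ℝ → ℝ} {a b : ℝ} (t₀ : ℝ)
    (hg : ∀ s, 0 < s → HasDerivAt g (g' s) s) (hg' : ContinuousOn g' (Ioi 0))
    (hx : Continuous x) (hy : Continuous y) (hpos : ∀ θ, 0 < x θ) :
    HasDerivAt (fun t => ∫ θ in a..b, g (x θ + (t - t₀) * y θ))
      (∫ θ in a..b, g' (x θ) * y θ) t₀ := by
  have hgc : ContinuousOn g (Ioi 0) := fun s hs => (hg s hs).continuousAt.continuousWithinAt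
  obtain ⟨θ₀, -, hmin⟩ := (isCompact_uIcc (a := a) (b := b)).exists_isMinOn nonempty_uIcc
    hx.continuousOn
  obtain ⟨X, hX⟩ := (isCompact_uIcc (a := a) (b := b)).exists_bound_of_continuousOn
    hx.continuousOn
  obtain ⟨Y, hY⟩ := (isCompact_uIcc (a := a) (b := b)).exists_bound_of_continuousOn
    hy.continuousOn
  have hY0 : 0 ≤ Y := (norm_nonneg _).trans (hY a left_mem_uIcc)
  set m := x θ₀
  have hm : 0 < m := hpos θ₀
  set δ := m / (2 * (Y + 1))
  have hδ : 0 < δ := by positivity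
  have hδY : δ * Y ≤ m / 2 := by
    have h : δ * (Y + 1) = m / 2 := by simp only [δ]; field_simp
    nlinarith
  have hsegment : ∀ t ∈ Metric.ball t₀ δ, ∀ θ ∈ uIcc a b,
      x θ + (t - t₀) * y θ ∈ Icc (m / 2) (X + m / 2) := by
    intro t ht θ hθ
    have h₁ : |(t - t₀) * y θ| ≤ m / 2 := by
      rw [abs_mul]
      refine (mul_le_mul ?_ (hY θ hθ) (abs_nonneg _) hδ.le).trans hδY
      rw [← Real.dist_eq]
      exact (Metric.mem_ball.1 ht).le
    have h₂ : m ≤ x θ := hmin hθ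
    have h₃ : x θ ≤ X := (le_abs_self _).trans (hX θ hθ)
    have h₄ := abs_le.1 h₁
    exact ⟨by linarith [h₄.1], by linarith [h₄.2]⟩
  have hsub : Icc (m / 2) (X + m / 2) ⊆ Ioi (0 : ℝ) := fun s hs => (half_pos hm).trans_le hs.1
  obtain ⟨K, hK⟩ := isCompact_Icc.exists_bound_of_continuousOn (hg'.mono hsub)
  have hF : ∀ t ∈ Metric.ball t₀ δ,
      ContinuousOn (fun θ => g (x θ + (t - t₀) * y θ)) (uIcc a b) := fun t ht =>
    hgc.comp (by fun_prop) fun θ hθ => hsub (hsegment t ht θ hθ)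
  have hF' : Continuous fun θ => g' (x θ) * y θ :=
    (hg'.comp_continuous hx hpos).mul hy
  have key := intervalIntegral.hasDerivAt_integral_of_dominated_loc_of_deriv_le
    (μ := MeasureTheory.volume) (a := a) (b := b) (x₀ := t₀) (s := Metric.ball t₀ δ)
    (F := fun t θ => g (x θ + (t - t₀) * y θ))
    (F' := fun t θ => g' (x θ + (t - t₀) * y θ) * y θ) (bound := fun _ => K * Y)
    (Metric.ball_mem_nhds _ hδ) ?_ ?_ ?_ ?_ ?_ ?_
  · simpa using key.2
  · filter_upwards [Metric.ball_mem_nhds t₀ hδ] with t ht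
    exact ((hF t ht).mono uIoc_subset_uIcc).aestronglyMeasurable measurableSet_uIoc
  · exact (hF t₀ (Metric.mem_ball_self hδ)).intervalIntegrable
  · simpa using hF'.aestronglyMeasurable
  · refine .of_forall fun θ hθ t ht => ?_
    have hθ' := uIoc_subset_uIcc hθ
    rw [norm_mul]
    have h := hK _ (hsegment t ht θ hθ')
    exact mul_le_mul h (hY θ hθ') (norm_nonneg _) ((norm_nonneg _).trans h)
  · exact intervalIntegrable_const
  · refine .of_forall fun θ hθ t ht => ?_
    have h := hg _ (hsub (hsegment t ht θ (uIoc_subset_uIcc hθ)))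
    have hl : HasDerivAt (fun t => x θ + (t - t₀) * y θ) (y θ) t := by
      simpa using (((hasDerivAt_id t).sub_const t₀).mul_const (y θ)).const_add (x θ)
    exact h.comp t hl

/-- The quadratic form `a cos² θ + c sin² θ` of the elliptic integrals in symmetric form. -/
noncomputable def ellipticWeight (a c θ : ℝ) : ℝ := a * Real.cos θ ^ 2 + c * Real.sin θ ^ 2

/-- The complete elliptic integral of the first kind, `∫ (a cos² θ + c sin² θ)^(-1/2) dθ`. -/
noncomputable def ellipticFirst (a c : ℝ) : ℝ :=
  ∫ θ in (0 : ℝ)..Real.pi / 2, (√(ellipticWeight a c θ))⁻¹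

/-- The complete elliptic integral of the second kind, `∫ (a cos² θ + c sin² θ)^(1/2) dθ`. -/
noncomputable def ellipticSecond (a c : ℝ) : ℝ :=
  ∫ θ in (0 : ℝ)..Real.pi / 2, √(ellipticWeight a c θ)

@[fun_prop]
theorem continuous_ellipticWeight (a c : ℝ) : Continuous (ellipticWeight a c) := by
  unfold ellipticWeight
  fun_prop

theorem ellipticWeight_pos {a c : ℝ} (ha : 0 < a) (hc : 0 < c) (θ : ℝ) :
    0 < ellipticWeight a c θ := by
  unfold ellipticWeight
  have h := Real.sin_sq_add_cos_sq θ
  nlinarith [mul_nonneg ha.le (sq_nonneg (Real.cos θ)), mul_nonneg hc.le (sq_nonneg (Real.sin θ)),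
    mul_pos ha hc, sq_nonneg (Real.cos θ), sq_nonneg (Real.sin θ)]

theorem sqrt_ellipticWeight_pos {a c : ℝ} (ha : 0 < a) (hc : 0 < c) (θ : ℝ) :
    0 < √(ellipticWeight a c θ) :=
  Real.sqrt_pos.2 (ellipticWeight_pos ha hc θ)

theorem continuous_inv_sqrt_ellipticWeight {a c : ℝ} (ha : 0 < a) (hc : 0 < c) :
    Continuous fun θ => (√(ellipticWeight a c θ))⁻¹ :=
  (by fun_prop : Continuous fun θ => √(ellipticWeight a c θ)).inv₀
    fun θ => (sqrt_ellipticWeight_pos ha hc θ).ne'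

theorem ellipticFirst_pos {a c : ℝ} (ha : 0 < a) (hc : 0 < c) : 0 < ellipticFirst a c :=
  intervalIntegral.intervalIntegral_pos_of_pos_on
    ((continuous_inv_sqrt_ellipticWeight ha hc).intervalIntegrable _ _)
    (fun θ _ => inv_pos.2 (sqrt_ellipticWeight_pos ha hc θ)) (by positivity)

theorem hasDerivAt_ellipticWeight (a c θ : ℝ) :
    HasDerivAt (ellipticWeight a c) (2 * (c - a) * Real.sin θ * Real.cos θ) θ := by
  refine ((((Real.hasDerivAt_cos θ).pow 2).const_mul a).add
    (((Real.hasDerivAt_sin θ).pow 2).const_mul c)).congr_deriv ?_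
  simp only [Nat.cast_ofNat]
  ring

/-- `∫ w^(-3/2)` in terms of the elliptic integral of the second kind, where `w` is the
elliptic weight. -/
theorem integral_inv_sqrt_ellipticWeight_pow_three {a c : ℝ} (ha : 0 < a) (hc : 0 < c) :
    a * c * ∫ θ in (0 : ℝ)..Real.pi / 2, (√(ellipticWeight a c θ))⁻¹ ^ 3 =
      ellipticSecond a c := by
  have hcont := continuous_inv_sqrt_ellipticWeight ha hc
  have hzero : ∫ θ in (0 : ℝ)..Real.pi / 2,
      (a - c) * ((Real.cos θ ^ 2 - Real.sin θ ^ 2) * (√(ellipticWeight a c θ))⁻¹ -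
        (c - a) * Real.sin θ ^ 2 * Real.cos θ ^ 2 * (√(ellipticWeight a c θ))⁻¹ ^ 3) = 0 := by
    rw [intervalIntegral.integral_eq_sub_of_hasDerivAt
      (f := fun θ => (a - c) * (Real.sin θ * Real.cos θ * (√(ellipticWeight a c θ))⁻¹))]
    · simp
    · intro θ _
      have hw := ellipticWeight_pos ha hc θ
      have hs := sqrt_ellipticWeight_pos ha hc θ
      refine ((((Real.hasDerivAt_sin θ).mul (Real.hasDerivAt_cos θ)).mul
        (((hasDerivAt_ellipticWeight a c θ).sqrt hw.ne').inv hs.ne')).const_mul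
          (a - c)).congr_deriv ?_
      simp only [Pi.mul_apply, Pi.inv_apply]
      field_simp
      ring
    · exact Continuous.intervalIntegrable (by fun_prop) _ _
  rw [ellipticSecond, ← intervalIntegral.integral_const_mul, ← sub_eq_zero,
    ← intervalIntegral.integral_sub (Continuous.intervalIntegrable (by fun_prop) _ _)
      (Continuous.intervalIntegrable (by fun_prop) _ _), ← neg_eq_zero,
    ← intervalIntegral.integral_neg]
  refine (intervalIntegral.integral_congr fun θ _ => ?_).trans hzero
  have hs := sqrt_ellipticWeight_pos ha hc θ
  have hsq : √(ellipticWeight a c θ) ^ 2 = a * Real.cos θ ^ 2 + c * Real.sin θ ^ 2 :=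
    Real.sq_sqrt (ellipticWeight_pos ha hc θ).le
  have hone := Real.sin_sq_add_cos_sq θ
  field_simp
  rw [show √(ellipticWeight a c θ) ^ 4 = (√(ellipticWeight a c θ) ^ 2) ^ 2 by ring, hsq]
  rw [show Real.cos θ ^ 2 = 1 - Real.sin θ ^ 2 by linarith]
  ring

/-- Derivative of the ratio of elliptic integrals along a line `(a + p t, c + q t)` whose direction
is `κ (1, 1) + μ (a, c)`. -/
theorem hasDerivAt_ellipticSecond_div_ellipticFirst {a c p q κ μ : ℝ} (ha : 0 < a) (hc : 0 < c)
    (hp : p = κ + μ * a) (hq : q = κ + μ * c) (t₀ : ℝ) :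
    HasDerivAt (fun t => ellipticSecond (a + (t - t₀) * p) (c + (t - t₀) * q) /
        ellipticFirst (a + (t - t₀) * p) (c + (t - t₀) * q))
      (κ / 2 + μ * (ellipticSecond a c / ellipticFirst a c) +
        κ * (ellipticSecond a c / ellipticFirst a c) ^ 2 / (2 * (a * c))) t₀ := by
  have hcont := continuous_inv_sqrt_ellipticWeight ha hc
  have hline : ∀ t θ, ellipticWeight (a + (t - t₀) * p) (c + (t - t₀) * q) θ =
      ellipticWeight a c θ + (t - t₀) * ellipticWeight p q θ := fun t θ => by
    unfold ellipticWeight; ring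
  have hdir : ∀ θ, ellipticWeight p q θ = κ + μ * √(ellipticWeight a c θ) ^ 2 := fun θ => by
    rw [Real.sq_sqrt (ellipticWeight_pos ha hc θ).le, ellipticWeight, ellipticWeight, hp, hq]
    linear_combination κ * Real.sin_sq_add_cos_sq θ
  have hsqrt : ∀ s : ℝ, 0 < s → HasDerivAt (fun s => √s) (1 / (2 * √s)) s := fun s hs =>
    Real.hasDerivAt_sqrt hs.ne'
  have hE := hasDerivAt_integral_comp_affine (a := 0) (b := Real.pi / 2) t₀ hsqrt
    (by
      refine continuousOn_const.div (by fun_prop) fun s hs => ?_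
      have := Real.sqrt_pos.2 hs
      positivity)
    (continuous_ellipticWeight a c) (continuous_ellipticWeight p q) (ellipticWeight_pos ha hc)
  have hD := hasDerivAt_integral_comp_affine (a := 0) (b := Real.pi / 2) t₀
    (g := fun s => (√s)⁻¹) (g' := fun s => -(1 / (2 * √s)) / √s ^ 2)
    (fun s hs => (hsqrt s hs).inv (Real.sqrt_pos.2 hs).ne')
    (by
      refine ContinuousOn.div (ContinuousOn.neg (continuousOn_const.div (by fun_prop) ?_))
        (by fun_prop) ?_ <;>
      · intro s hs
        have := Real.sqrt_pos.2 hs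
        positivity)
    (continuous_ellipticWeight a c) (continuous_ellipticWeight p q) (ellipticWeight_pos ha hc)
  have hE' : ∫ θ in (0 : ℝ)..Real.pi / 2,
      1 / (2 * √(ellipticWeight a c θ)) * ellipticWeight p q θ =
        κ / 2 * ellipticFirst a c + μ / 2 * ellipticSecond a c := by
    rw [ellipticFirst, ellipticSecond, ← intervalIntegral.integral_const_mul,
      ← intervalIntegral.integral_const_mul,
      ← intervalIntegral.integral_add (Continuous.intervalIntegrable (by fun_prop) _ _)
        (Continuous.intervalIntegrable (by fun_prop) _ _)]
    refine intervalIntegral.integral_congr fun θ _ => ?_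
    have hs := sqrt_ellipticWeight_pos ha hc θ
    simp only [hdir]
    field_simp
  have hD' : ∫ θ in (0 : ℝ)..Real.pi / 2,
      -(1 / (2 * √(ellipticWeight a c θ))) / √(ellipticWeight a c θ) ^ 2 * ellipticWeight p q θ =
        -(κ / (2 * (a * c)) * ellipticSecond a c + μ / 2 * ellipticFirst a c) := by
    rw [← integral_inv_sqrt_ellipticWeight_pow_three ha hc, ← mul_assoc, ellipticFirst,
      ← intervalIntegral.integral_const_mul, ← intervalIntegral.integral_const_mul,
      ← intervalIntegral.integral_add (Continuous.intervalIntegrable (by fun_prop) _ _)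
        (Continuous.intervalIntegrable (by fun_prop) _ _), ← intervalIntegral.integral_neg]
    refine intervalIntegral.integral_congr fun θ _ => ?_
    have hs := sqrt_ellipticWeight_pos ha hc θ
    simp only [hdir]
    field_simp
  rw [hE'] at hE
  rw [hD'] at hD
  have hpos := ellipticFirst_pos ha hc
  have hE₀ : (∫ θ in (0 : ℝ)..Real.pi / 2,
      √(ellipticWeight a c θ + (t₀ - t₀) * ellipticWeight p q θ)) = ellipticSecond a c := by
    simp [ellipticSecond]
  have hD₀ : (∫ θ in (0 : ℝ)..Real.pi / 2,
      (√(ellipticWeight a c θ + (t₀ - t₀) * ellipticWeight p q θ))⁻¹) = ellipticFirst a c := by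
    simp [ellipticFirst]
  have h := hE.div hD (by rw [hD₀]; exact hpos.ne')
  rw [hE₀, hD₀] at h
  refine (h.congr_of_eventuallyEq (.of_forall fun t => ?_)).congr_deriv ?_
  · simp only [ellipticFirst, ellipticSecond, hline, Pi.div_apply]
  field_simp
  ring

/-- The substitution `r = u₃ + (u₂ - u₃) sin² θ` in an integral over the gap `(u₃, u₂)`. -/
theorem integral_div_sqrt_cubic {u₁ u₂ u₃ : ℝ} (h12 : u₂ < u₁) (h23 : u₃ < u₂) (h : ℝ → ℝ) :
    ∫ r in u₃..u₂, h r / √((r - u₁) * (r - u₂) * (r - u₃)) =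
      ∫ θ in (0 : ℝ)..Real.pi / 2, 2 * h (u₁ - ellipticWeight (u₁ - u₃) (u₁ - u₂) θ) *
        (√(ellipticWeight (u₁ - u₃) (u₁ - u₂) θ))⁻¹ := by
  set f : ℝ → ℝ := fun θ => u₁ - ellipticWeight (u₁ - u₃) (u₁ - u₂) θ with hf
  have hpi : (0 : ℝ) < Real.pi / 2 := by positivity
  have hderiv : ∀ θ, HasDerivAt f (2 * (u₂ - u₃) * Real.sin θ * Real.cos θ) θ := fun θ =>
    ((hasDerivAt_ellipticWeight (u₁ - u₃) (u₁ - u₂) θ).const_sub u₁).congr_deriv (by ring)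
  have hsin : ∀ θ ∈ Ioo 0 (Real.pi / 2), 0 < Real.sin θ := fun θ hθ =>
    Real.sin_pos_of_mem_Ioo ⟨hθ.1, by linarith [hθ.2]⟩
  have hcos : ∀ θ ∈ Ioo 0 (Real.pi / 2), 0 < Real.cos θ := fun θ hθ =>
    Real.cos_pos_of_mem_Ioo ⟨by linarith [hθ.1], hθ.2⟩
  have hfcont : ContinuousOn f (Icc 0 (Real.pi / 2)) := fun θ _ =>
    (hderiv θ).continuousAt.continuousWithinAt
  have hmono : StrictMonoOn f (Icc 0 (Real.pi / 2)) := by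
    refine strictMonoOn_of_deriv_pos (convex_Icc _ _) hfcont fun θ hθ => ?_
    rw [interior_Icc] at hθ
    rw [(hderiv θ).deriv]
    have := hsin θ hθ
    have := hcos θ hθ
    have := sub_pos.2 h23
    positivity
  have himage : f '' Ioo 0 (Real.pi / 2) = Ioo u₃ u₂ := by
    rw [hfcont.image_Ioo_of_strictMonoOn hpi.le hmono]
    simp [hf, ellipticWeight]
  rw [intervalIntegral.integral_of_le h23.le, intervalIntegral.integral_of_le hpi.le,
    MeasureTheory.integral_Ioc_eq_integral_Ioo, MeasureTheory.integral_Ioc_eq_integral_Ioo,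
    ← himage, MeasureTheory.integral_image_eq_integral_abs_deriv_smul measurableSet_Ioo
      (fun θ _ => (hderiv θ).hasDerivWithinAt) (hmono.injOn.mono Ioo_subset_Icc_self)]
  refine MeasureTheory.setIntegral_congr_fun measurableSet_Ioo fun θ hθ => ?_
  have hs := hsin θ hθ
  have hc := hcos θ hθ
  have hu := sub_pos.2 h23
  have hw := sqrt_ellipticWeight_pos (sub_pos.2 (h23.trans h12)) (sub_pos.2 h12) θ
  have hsq := Real.sq_sqrt
    (ellipticWeight_pos (sub_pos.2 (h23.trans h12)) (sub_pos.2 h12) θ).le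
  have hprod : (f θ - u₁) * (f θ - u₂) * (f θ - u₃) =
      (√(ellipticWeight (u₁ - u₃) (u₁ - u₂) θ) * ((u₂ - u₃) * Real.sin θ * Real.cos θ)) ^ 2 := by
    have h₂ : f θ - u₂ = -((u₂ - u₃) * Real.cos θ ^ 2) := by
      simp only [hf, ellipticWeight]
      linear_combination (u₂ - u₁) * Real.sin_sq_add_cos_sq θ
    have h₃ : f θ - u₃ = (u₂ - u₃) * Real.sin θ ^ 2 := by
      simp only [hf, ellipticWeight]
      linear_combination (u₃ - u₁) * Real.sin_sq_add_cos_sq θ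
    rw [h₂, h₃, mul_pow, hsq]
    simp only [hf]
    ring
  simp only [smul_eq_mul]
  rw [hprod, Real.sqrt_sq (by positivity), abs_of_pos (by positivity)]
  simp only [hf]
  field_simp

theorem alpha0_eq {u₁ u₂ u₃ : ℝ} (h12 : u₂ < u₁) (h23 : u₃ < u₂) :
    alpha0 u₁ u₂ u₃ =
      -u₁ + ellipticSecond (u₁ - u₃) (u₁ - u₂) / ellipticFirst (u₁ - u₃) (u₁ - u₂) := by
  have ha := sub_pos.2 (h23.trans h12)
  have hc := sub_pos.2 h12
  have hcont := continuous_inv_sqrt_ellipticWeight ha hc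
  have hpos := ellipticFirst_pos ha hc
  have hden : ∫ r in u₃..u₂, (1 : ℝ) / √((r - u₁) * (r - u₂) * (r - u₃)) =
      2 * ellipticFirst (u₁ - u₃) (u₁ - u₂) := by
    rw [integral_div_sqrt_cubic h12 h23 fun _ => 1, ellipticFirst,
      ← intervalIntegral.integral_const_mul]
    simp
  have hnum : ∫ r in u₃..u₂, r / √((r - u₁) * (r - u₂) * (r - u₃)) =
      2 * u₁ * ellipticFirst (u₁ - u₃) (u₁ - u₂) - 2 * ellipticSecond (u₁ - u₃) (u₁ - u₂) := by
    rw [integral_div_sqrt_cubic h12 h23 fun r => r, ellipticFirst, ellipticSecond,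
      ← intervalIntegral.integral_const_mul, ← intervalIntegral.integral_const_mul,
      ← intervalIntegral.integral_sub (Continuous.intervalIntegrable (by fun_prop) _ _)
        (Continuous.intervalIntegrable (by fun_prop) _ _)]
    refine intervalIntegral.integral_congr fun θ _ => ?_
    have hs := sqrt_ellipticWeight_pos ha hc θ
    have hsq := Real.sq_sqrt (ellipticWeight_pos ha hc θ).le
    field_simp
    rw [hsq]
  rw [alpha0, hden, hnum]
  field_simp
  ring

/-- For u₁ > u₂ > u₃, α₀ is differentiable in each u_i with
    ∂α₀/∂u_i = −1/2 + (1/2)(α₀ + u_i)²/∏_{j≠i}(u_i − u_j). -/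
theorem stmt19 (u₁ u₂ u₃ : ℝ) (h12 : u₂ < u₁) (h23 : u₃ < u₂) :
    HasDerivAt (fun a => alpha0 a u₂ u₃)
      (-(1 / 2) + 1 / 2 * (alpha0 u₁ u₂ u₃ + u₁) ^ 2 / ((u₁ - u₂) * (u₁ - u₃))) u₁ ∧
    HasDerivAt (fun a => alpha0 u₁ a u₃)
      (-(1 / 2) + 1 / 2 * (alpha0 u₁ u₂ u₃ + u₂) ^ 2 / ((u₂ - u₁) * (u₂ - u₃))) u₂ ∧
    HasDerivAt (fun a => alpha0 u₁ u₂ a)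
      (-(1 / 2) + 1 / 2 * (alpha0 u₁ u₂ u₃ + u₃) ^ 2 / ((u₃ - u₁) * (u₃ - u₂))) u₃ := by
  have ha := sub_pos.2 (h23.trans h12)
  have hc := sub_pos.2 h12
  have hb := sub_pos.2 h23
  rw [alpha0_eq h12 h23]
  refine ⟨?_, ?_, ?_⟩
  · have h := (hasDerivAt_neg u₁).add (hasDerivAt_ellipticSecond_div_ellipticFirst ha hc
      (p := 1) (q := 1) (κ := 1) (μ := 0) (by simp) (by simp) u₁)
    refine (h.congr_of_eventuallyEq ?_).congr_deriv ?_
    · filter_upwards [lt_mem_nhds h12] with t ht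
      rw [alpha0_eq ht h23]
      simp
    · field_simp
      ring
  · have h := (hasDerivAt_ellipticSecond_div_ellipticFirst ha hc
      (p := 0) (q := -1) (κ := -(u₁ - u₃) / (u₂ - u₃)) (μ := 1 / (u₂ - u₃))
      (by field_simp; ring) (by field_simp; ring) u₂).const_add (-u₁)
    refine (h.congr_of_eventuallyEq ?_).congr_deriv ?_
    · filter_upwards [lt_mem_nhds h23, gt_mem_nhds h12] with t ht ht'
      rw [alpha0_eq ht' ht]
      simp
    · generalize ellipticSecond (u₁ - u₃) (u₁ - u₂) / ellipticFirst (u₁ - u₃) (u₁ - u₂) = R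
      rw [← neg_sub u₁ u₂]
      field_simp
      ring
  · have h := (hasDerivAt_ellipticSecond_div_ellipticFirst ha hc
      (p := -1) (q := 0) (κ := (u₁ - u₂) / (u₂ - u₃)) (μ := -1 / (u₂ - u₃))
      (by field_simp; ring) (by field_simp; ring) u₃).const_add (-u₁)
    refine (h.congr_of_eventuallyEq ?_).congr_deriv ?_
    · filter_upwards [gt_mem_nhds h23] with t ht
      rw [alpha0_eq h12 ht]
      simp
    · generalize ellipticSecond (u₁ - u₃) (u₁ - u₂) / ellipticFirst (u₁ - u₃) (u₁ - u₂) = R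
      rw [← neg_sub u₁ u₃, ← neg_sub u₂ u₃]
      field_simp
      ring
end
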